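/- Let k ≥ 2, n = k(k+1)/2, and let α be an n-tuple of pairwise independent irrational numbers with k(α) = k. Then there exists T > 1 such that for every t_0 ≥ T, with the functions enumerated as ψ_{i,j} according to their decreasing order at t_0, each function ψ_{i,j} with 1 ≤ i < j ≤ k is discontinuous at every point of the set S = {t_{i+sk} : s ≥ 0} ∪ {t_{j+sk} : s ≥ 0}, where {t_m} is the sequence of moments of permutation changes, and is continuous at every real t ≥ t_i with t ∉ S. -/

import Mathlib

/-- Distance from `x` to the nearest integer. -/
noncomputable def distToInt (x : ℝ) : ℝ := |x - round x|

/-- The irrationality measure function `ψ_α(t) = min_{1 ≤ q ≤ t} ‖qα‖`. -/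
noncomputable def psi (α : ℝ) (t : ℝ) : ℝ :=
  sInf ((fun q : ℤ => distToInt ((q : ℝ) * α)) '' {q : ℤ | 1 ≤ q ∧ (q : ℝ) ≤ t})

/-- An `n`-tuple is pairwise independent if eventually all the values
`ψ_{α_i}(t)` are pairwise distinct. -/
def PairwiseIndependent {n : ℕ} (α : Fin n → ℝ) : Prop :=
  ∃ T : ℝ, 0 ≤ T ∧ ∀ t : ℝ, T ≤ t → ∀ i j : Fin n, i ≠ j → psi (α i) t ≠ psi (α j) t

/-- `v : Fin n → Fin n` is the order vector of `α` at time `t`: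
`ψ_{α_{v 0}}(t) > ψ_{α_{v 1}}(t) > … > ψ_{α_{v (n-1)}}(t)`. -/
def IsOrderVec {n : ℕ} (α : Fin n → ℝ) (t : ℝ) (v : Fin n → Fin n) : Prop :=
  Function.Bijective v ∧
    ∀ p q : Fin n, p < q → psi (α (v p)) t > psi (α (v q)) t

/-- The order vector `v` occurs at arbitrarily large times. -/
def OccursInfinitely {n : ℕ} (α : Fin n → ℝ) (v : Fin n → Fin n) : Prop :=
  ∀ T : ℝ, ∃ t : ℝ, T < t ∧ IsOrderVec α t v

/-- `k(α)`: the number of distinct order vectors occurring for arbitrarily large `t`. -/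
noncomputable def kAlpha {n : ℕ} (α : Fin n → ℝ) : ℕ :=
  Nat.card {v : Fin n → Fin n | OccursInfinitely α v}

/-- The relative order of the functions `ψ_{α_i}` is the same at times `t` and `t'`
(i.e. the order vectors coincide). -/
def SameOrder {n : ℕ} (α : Fin n → ℝ) (t t' : ℝ) : Prop :=
  ∀ i j : Fin n, (psi (α i) t < psi (α j) t ↔ psi (α i) t' < psi (α j) t')

/-- `ts` is a sequence of moments of permutation changes:
`ts (i+1) = min { t > ts i : v_α(t) ≠ v_α(ts i) }`. -/
def IsChangeSeq {n : ℕ} (α : Fin n → ℝ) (ts : ℕ → ℝ) : Prop :=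
  ∀ i : ℕ, IsLeast {t : ℝ | ts i < t ∧ ¬ SameOrder α (ts i) t} (ts (i + 1))

/-- The set of positions `(j,l)`, `1 ≤ j ≤ l ≤ k` (here `0`-based). -/
def PairIdx (k : ℕ) := {p : Fin k × Fin k // p.1 ≤ p.2}

/-- Construct a position from `0`-based indices `j ≤ l < k`. -/
def mkPos {k : ℕ} (j l : ℕ) (hj : j ≤ l) (hl : l < k) : PairIdx k :=
  ⟨(⟨j, lt_of_le_of_lt hj hl⟩, ⟨l, hl⟩), Fin.mk_le_mk.mpr hj⟩

/-- The position permutation underlying `π`: one has `π(u) = u ∘ tau`.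
In `1`-based notation: `tau (i,i) = (i+1,i+1)` for `i < k`, `tau (k,k) = (1,1)`,
`tau (i,k) = (1,i+1)` for `i < k`, and `tau (i,j) = (i+1,j+1)` otherwise. -/
def tau {k : ℕ} (p : PairIdx k) : PairIdx k :=
  if h2 : p.1.2.val = k - 1 then
    if h1 : p.1.1.val = k - 1 then
      ⟨(⟨0, by have := p.1.2.isLt; omega⟩, ⟨0, by have := p.1.2.isLt; omega⟩), le_refl _⟩
    else
      ⟨(⟨0, by have := p.1.2.isLt; omega⟩,
        ⟨p.1.1.val + 1, by have := p.1.1.isLt; omega⟩),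
       Fin.mk_le_mk.mpr (by omega)⟩
  else
    ⟨(⟨p.1.1.val + 1, by have h := p.1.2.isLt; have h' : p.1.1.val ≤ p.1.2.val := p.2; omega⟩,
      ⟨p.1.2.val + 1, by have h := p.1.2.isLt; omega⟩),
     Fin.mk_le_mk.mpr (by have h' : p.1.1.val ≤ p.1.2.val := p.2; omega)⟩

/-- The action of `π` on vectors indexed by positions: `π(u) = u ∘ tau`. -/
def piMap {k : ℕ} {X : Type*} (u : PairIdx k → X) : PairIdx k → X :=
  fun p => u (tau p)

/-- The (`0`-based) linear position of the pair `(j,l)` in the special enumeration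
`u_{1,1}, u_{1,k}, u_{1,k-1}, …, u_{1,2}, u_{2,2}, u_{2,k}, …, u_{k,k}`. -/
def posIdx {k : ℕ} (p : PairIdx k) : ℕ :=
  (p.1.1.val * k - p.1.1.val * (p.1.1.val - 1) / 2) +
    (if p.1.2.val = p.1.1.val then 0 else k - p.1.2.val)

/-- `v : PairIdx k → Fin n` is the order vector of `α` at time `t`, written in the
special pair enumeration: the function at position `p` is larger than the one at
position `q` whenever `p` precedes `q` in the enumeration. -/
def IsOrderVecP {n k : ℕ} (α : Fin n → ℝ) (t : ℝ) (v : PairIdx k → Fin n) : Prop :=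
  Function.Bijective v ∧
    ∀ p q : PairIdx k, posIdx p < posIdx q → psi (α (v p)) t > psi (α (v q)) t

/-- Denominator `q_m` of the `m`-th convergent of the continued fraction of `α`. -/
noncomputable def cfDen (α : ℝ) (m : ℕ) : ℝ := (GenContFract.of α).dens m

/-- The orbit equivalence relation of the map `tau` on positions. -/
def orbitSetoid (k : ℕ) : Setoid (PairIdx k) where
  r p q := ∃ a b : ℕ, (fun x : PairIdx k => tau x)^[a] p = (fun x : PairIdx k => tau x)^[b] q
  iseqv := by
    constructor
    · exact fun p => ⟨0, 0, rfl⟩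
    · rintro p q ⟨a, b, h⟩; exact ⟨b, a, h.symm⟩
    · rintro p q r ⟨a, b, h1⟩ ⟨c, d, h2⟩
      refine ⟨c + a, b + d, ?_⟩
      rw [Function.iterate_add_apply, h1, ← Function.iterate_add_apply,
        Nat.add_comm c b, Function.iterate_add_apply, h2, ← Function.iterate_add_apply]

/-! ### Staircase functions and their consecutive jumps -/

/-- `a < b` are consecutive jumps of `f`, where `1` counts as a jump. -/
def Consec (f : ℕ → ℝ) (a b : ℕ) : Prop :=
  1 ≤ a ∧ a < b ∧ (a = 1 ∨ f a < f (a - 1)) ∧ f b < f (b - 1) ∧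
    ∀ c, a ≤ c → c < b → f c = f a

/-- The properties of irrationality measure functions, at integer arguments, used below. -/
structure IsStair (f : ℕ → ℝ) : Prop where
  anti : ∀ a b, 1 ≤ a → a ≤ b → f b ≤ f a
  pos : ∀ a, 1 ≤ a → 0 < f a
  exists_consec : ∀ t, 1 ≤ t → ∃ a b, Consec f a b ∧ a ≤ t ∧ t < b
  det : ∀ a b, Consec f a b → f a * b + f b * a = 1
  coprime : ∀ a b, Consec f a b → Nat.Coprime a b
  recur : ∀ a b c, Consec f a b → Consec f b c → ∃ m, 1 ≤ m ∧ c = m * b + a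

namespace IsStair

section PsiIsStair

variable {α : ℝ}

lemma distToInt_le (x : ℝ) (z : ℤ) : distToInt x ≤ |x - z| := round_le x z

lemma distToInt_pos (hα : Irrational α) {q : ℕ} (hq : 1 ≤ q) : 0 < distToInt ((q : ℝ) * α) := by
  unfold distToInt
  rw [abs_pos, sub_ne_zero]
  have h : Irrational ((q : ℝ) * α) := hα.natCast_mul (by omega)
  exact h.ne_int _

lemma psi_eq_floor (α : ℝ) {t : ℝ} (ht : 0 ≤ t) : psi α t = psi α (⌊t⌋₊ : ℕ) := by
  unfold psi
  congr 2
  ext q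
  simp only [Set.mem_ofPred_eq]
  refine and_congr_right fun hq => ?_
  lift q to ℕ using by omega
  have h := Nat.le_floor_iff ht (n := q)
  constructor
  · intro h1
    exact_mod_cast h.2 (by exact_mod_cast h1)
  · intro h1
    exact_mod_cast h.1 (by exact_mod_cast h1)

lemma psi_le (α : ℝ) {q N : ℕ} (hq : 1 ≤ q) (hqN : q ≤ N) :
    psi α N ≤ distToInt ((q : ℝ) * α) := by
  refine csInf_le ⟨0, ?_⟩ ⟨(q : ℤ), ⟨by exact_mod_cast hq, by exact_mod_cast hqN⟩, by simp⟩
  rintro _ ⟨z, -, rfl⟩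
  exact abs_nonneg _

lemma exists_psi_eq (α : ℝ) {N : ℕ} (hN : 1 ≤ N) :
    ∃ q : ℕ, 1 ≤ q ∧ q ≤ N ∧ psi α N = distToInt ((q : ℝ) * α) := by
  have hfin : {q : ℤ | 1 ≤ q ∧ (q : ℝ) ≤ (N : ℝ)}.Finite := by
    refine (Set.finite_Icc (1 : ℤ) N).subset ?_
    rintro q ⟨h1, h2⟩
    exact ⟨h1, by exact_mod_cast h2⟩
  have hne : ((fun q : ℤ => distToInt ((q : ℝ) * α)) ''
      {q : ℤ | 1 ≤ q ∧ (q : ℝ) ≤ (N : ℝ)}).Nonempty :=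
    ⟨_, ⟨1, ⟨le_refl _, by exact_mod_cast hN⟩, rfl⟩⟩
  obtain ⟨q, ⟨h1, h2⟩, h3⟩ := hne.csInf_mem (hfin.image _)
  lift q to ℕ using by omega
  exact ⟨q, by exact_mod_cast h1, by exact_mod_cast h2, by simpa [psi] using h3.symm⟩

lemma psi_anti (α : ℝ) {a b : ℕ} (ha : 1 ≤ a) (hab : a ≤ b) : psi α b ≤ psi α a := by
  obtain ⟨q, h1, h2, h3⟩ := exists_psi_eq α ha
  rw [h3]
  exact psi_le α h1 (h2.trans hab)

lemma psi_pos (hα : Irrational α) {a : ℕ} (ha : 1 ≤ a) : 0 < psi α a := by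
  obtain ⟨q, h1, h2, h3⟩ := exists_psi_eq α ha
  rw [h3]
  exact distToInt_pos hα h1

lemma psi_mul_le (α : ℝ) {N : ℕ} (hN : 1 ≤ N) : psi α N * (N + 1) ≤ 1 := by
  obtain ⟨j, m, hm, hmN, h⟩ := Real.exists_int_int_abs_mul_sub_le α (n := N) (by omega)
  lift m to ℕ using hm.le
  have h1 : psi α N ≤ 1 / ((N : ℝ) + 1) :=
    (psi_le α (q := m) (by omega) (by omega)).trans ((distToInt_le _ j).trans (by simpa using h))
  have h2 : (0 : ℝ) < (N : ℝ) + 1 := by positivity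
  exact (le_div_iff₀ h2).1 h1

lemma psi_eq_of_jump (α : ℝ) {a : ℕ} (ha : 1 ≤ a) (h : a = 1 ∨ psi α a < psi α (a - 1 : ℕ)) :
    psi α a = distToInt ((a : ℝ) * α) := by
  obtain ⟨q, h1, h2, h3⟩ := exists_psi_eq α ha
  rcases eq_or_lt_of_le h2 with rfl | h4
  · exact h3
  · exfalso
    rcases h with rfl | h
    · omega
    · have := psi_le α h1 (show q ≤ a - 1 by omega)
      linarith

/-- Consecutive best approximations lie on opposite sides and span a unimodular lattice. -/
lemma consec_signs (hα : Irrational α) {a b : ℕ} (h : Consec (fun N : ℕ => psi α N) a b) :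
    (0 < (a : ℝ) * α - round ((a : ℝ) * α) ∧ (b : ℝ) * α - round ((b : ℝ) * α) < 0 ∧
      (b : ℤ) * round ((a : ℝ) * α) - a * round ((b : ℝ) * α) = -1 ∧
      psi α a * b + psi α b * a = 1) ∨
    ((a : ℝ) * α - round ((a : ℝ) * α) < 0 ∧ 0 < (b : ℝ) * α - round ((b : ℝ) * α) ∧
      (b : ℤ) * round ((a : ℝ) * α) - a * round ((b : ℝ) * α) = 1 ∧
      psi α a * b + psi α b * a = 1) := by
  obtain ⟨ha, hab, hja, hjb, hc⟩ := h
  have ea : psi α a = |(a : ℝ) * α - round ((a : ℝ) * α)| := psi_eq_of_jump α ha hja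
  have eb : psi α b = |(b : ℝ) * α - round ((b : ℝ) * α)| :=
    psi_eq_of_jump α (by omega) (Or.inr hjb)
  have hpa := psi_pos hα ha
  have hpb := psi_pos hα (show 1 ≤ b by omega)
  have hb1 : psi α (b - 1 : ℕ) = psi α a := hc (b - 1) (by omega) (by omega)
  have hlt : psi α b < psi α a := by rw [← hb1]; exact hjb
  have hup : psi α a * b ≤ 1 := by
    have := psi_mul_le α (show 1 ≤ b - 1 by omega)
    rw [hb1] at this
    have e : ((b - 1 : ℕ) : ℝ) + 1 = b := by
      rw [Nat.cast_sub (by omega)]; simp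
    rwa [e] at this
  have hab' : (a : ℝ) < b := by exact_mod_cast hab
  have ha' : (0 : ℝ) < a := by exact_mod_cast ha
  have hlow : psi α b * a < 1 := by nlinarith
  have hdiff : psi α a ≤ |((b : ℝ) * α - round ((b : ℝ) * α)) -
      ((a : ℝ) * α - round ((a : ℝ) * α))| := by
    have h1 := psi_le α (show 1 ≤ b - a by omega) (show b - a ≤ b - 1 by omega)
    rw [hb1] at h1
    refine h1.trans ((distToInt_le _ (round ((b : ℝ) * α) - round ((a : ℝ) * α))).trans
      (le_of_eq ?_))
    rw [Nat.cast_sub hab.le]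
    push_cast
    congr 1
    ring
  set r := round ((a : ℝ) * α)
  set r' := round ((b : ℝ) * α)
  set ε := (a : ℝ) * α - r with hε
  set ε' := (b : ℝ) * α - r' with hε'
  have hD : (a : ℝ) * ε' - b * ε = (((b : ℤ) * r - a * r' : ℤ) : ℝ) := by
    push_cast; rw [hε, hε']; ring
  rcases lt_trichotomy ε 0 with h0 | h0 | h0
  · rw [abs_of_neg h0] at ea
    rcases lt_trichotomy ε' 0 with h1 | h1 | h1
    · exfalso
      rw [abs_of_neg h1] at eb
      have : |ε' - ε| < psi α a := by rw [abs_lt]; constructor <;> linarith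
      linarith
    · rw [h1, abs_zero] at eb; linarith
    · right
      rw [abs_of_pos h1] at eb
      have e1 : (((b : ℤ) * r - a * r' : ℤ) : ℝ) = psi α a * b + psi α b * a := by
        rw [← hD, ea, eb]; ring
      have l1 : (0 : ℝ) < (((b : ℤ) * r - a * r' : ℤ) : ℝ) := by rw [e1]; nlinarith
      have l2 : (((b : ℤ) * r - a * r' : ℤ) : ℝ) < (2 : ℤ) := by rw [e1]; push_cast; linarith
      have l1' : 0 < (b : ℤ) * r - a * r' := by exact_mod_cast l1
      have l2' : (b : ℤ) * r - a * r' < 2 := by exact_mod_cast l2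
      have e2 : (b : ℤ) * r - a * r' = 1 := by omega
      refine ⟨h0, h1, e2, ?_⟩
      rw [← e1, e2]; simp
  · rw [h0, abs_zero] at ea; linarith
  · rw [abs_of_pos h0] at ea
    rcases lt_trichotomy ε' 0 with h1 | h1 | h1
    · left
      rw [abs_of_neg h1] at eb
      have e1 : (((b : ℤ) * r - a * r' : ℤ) : ℝ) = -(psi α a * b + psi α b * a) := by
        rw [← hD, ea, eb]; ring
      have l1 : (((b : ℤ) * r - a * r' : ℤ) : ℝ) < 0 := by rw [e1]; nlinarith
      have l2 : ((-2 : ℤ) : ℝ) < (((b : ℤ) * r - a * r' : ℤ) : ℝ) := by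
        rw [e1]; push_cast; linarith
      have l1' : (b : ℤ) * r - a * r' < 0 := by exact_mod_cast l1
      have l2' : -2 < (b : ℤ) * r - a * r' := by exact_mod_cast l2
      have e2 : (b : ℤ) * r - a * r' = -1 := by omega
      refine ⟨h0, h1, e2, ?_⟩
      have : psi α a * b + psi α b * a = -(((b : ℤ) * r - a * r' : ℤ) : ℝ) := by rw [e1]; ring
      rw [this, e2]; simp
    · rw [h1, abs_zero] at eb; linarith
    · exfalso
      rw [abs_of_pos h1] at eb
      have : |ε' - ε| < psi α a := by rw [abs_lt]; constructor <;> linarith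
      linarith

theorem psi_isStair (hα : Irrational α) : IsStair (fun N : ℕ => psi α N) where
  anti a b ha hab := psi_anti α ha hab
  pos a ha := psi_pos hα ha
  det a b h := by
    rcases consec_signs hα h with ⟨-, -, -, h⟩ | ⟨-, -, -, h⟩ <;> exact h
  coprime a b h := by
    rw [← Nat.isCoprime_iff_coprime]
    rcases consec_signs hα h with ⟨-, -, h, -⟩ | ⟨-, -, h, -⟩
    · exact ⟨round ((b : ℝ) * α), -round ((a : ℝ) * α), by linarith⟩
    · exact ⟨-round ((b : ℝ) * α), round ((a : ℝ) * α), by linarith⟩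
  recur a b c hab hbc := by
    have key : (round ((b : ℝ) * α) : ℤ) * ((c : ℤ) - a) =
        b * (round ((c : ℝ) * α) - round ((a : ℝ) * α)) := by
      rcases consec_signs hα hab with ⟨_, h1, h2, _⟩ | ⟨_, h1, h2, _⟩ <;>
      rcases consec_signs hα hbc with ⟨h3, _, h4, _⟩ | ⟨h3, _, h4, _⟩ <;>
      first
      | linarith
    have hcop : IsCoprime (b : ℤ) (round ((b : ℝ) * α)) := by
      rcases consec_signs hα hab with ⟨-, -, h, -⟩ | ⟨-, -, h, -⟩
      · exact ⟨-round ((a : ℝ) * α), a, by linarith⟩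
      · exact ⟨round ((a : ℝ) * α), -a, by linarith⟩
    have hdvd : (b : ℤ) ∣ (c : ℤ) - a := hcop.dvd_of_dvd_mul_left ⟨_, key⟩
    have h1 := hab.2.1
    have h2 := hbc.2.1
    have h3 := hab.1
    obtain ⟨m, hm⟩ := hdvd
    have hm0 : 0 < m := by
      by_contra hm0
      have : (b : ℤ) * m ≤ 0 := mul_nonpos_of_nonneg_of_nonpos (by omega) (by omega)
      omega
    lift m to ℕ using hm0.le
    refine ⟨m, by omega, ?_⟩
    have : (c : ℤ) = m * b + a := by linarith
    exact_mod_cast this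
  exists_consec t ht := by
    classical
    have hex : ∃ c : ℕ, 1 ≤ c ∧ psi α c = psi α t := ⟨t, ht, rfl⟩
    have hex' : ∃ c : ℕ, t < c ∧ psi α c < psi α t := by
      obtain ⟨N, hN⟩ := exists_nat_gt (1 / psi α t)
      have hp := psi_pos hα ht
      refine ⟨max N (t + 1), by omega, ?_⟩
      have h1 := psi_mul_le α (show 1 ≤ max N (t + 1) by omega)
      have h2 := psi_pos hα (show 1 ≤ max N (t + 1) by omega)
      have h3 : (N : ℝ) ≤ (max N (t + 1) : ℕ) := by exact_mod_cast le_max_left _ _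
      rw [div_lt_iff₀ hp] at hN
      by_contra hcon
      push Not at hcon
      nlinarith
    obtain ⟨ha1, ha2⟩ := Nat.find_spec hex
    obtain ⟨hb1, hb2⟩ := Nat.find_spec hex'
    have hamin : ∀ c, 1 ≤ c → c < Nat.find hex → psi α c ≠ psi α t := fun c h1 h2 h3 =>
      Nat.find_min hex h2 ⟨h1, h3⟩
    have hbmin : ∀ c, t < c → c < Nat.find hex' → ¬ psi α c < psi α t := fun c h1 h2 h3 =>
      Nat.find_min hex' h2 ⟨h1, h3⟩
    have hat : Nat.find hex ≤ t := Nat.find_min' hex ⟨ht, rfl⟩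
    generalize Nat.find hex = a at *
    generalize Nat.find hex' = b at *
    have hconst : ∀ c, a ≤ c → c < b → psi α c = psi α t := by
      intro c h1 h2
      rcases le_or_gt c t with h3 | h3
      · exact le_antisymm (ha2 ▸ psi_anti α ha1 h1) (psi_anti α (by omega) h3)
      · exact le_antisymm (psi_anti α ht h3.le) (not_lt.1 (hbmin c h3 h2))
    refine ⟨a, b, ⟨ha1, by omega, ?_, ?_, ?_⟩, hat, hb1⟩
    · rcases eq_or_lt_of_le ha1 with h | h
      · exact Or.inl h.symm
      · right
        refine lt_of_le_of_ne (psi_anti α (by omega) (by omega)) fun h' => ?_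
        exact hamin (a - 1) (by omega) (by omega) (h'.symm.trans ha2)
    · have := hconst (b - 1) (by omega) (by omega)
      simp only
      rw [this]; exact hb2
    · intro c h1 h2
      simp only
      rw [hconst c h1 h2, ha2]

end PsiIsStair
end IsStair

/-- `f` drops at `b`. -/
def Drops (f : ℕ → ℝ) (b : ℕ) : Prop := 2 ≤ b ∧ f b < f (b - 1)

namespace Consec

variable {f : ℕ → ℝ} {a b c d : ℕ}

lemma one_le (h : Consec f a b) : 1 ≤ a := h.1

lemma lt (h : Consec f a b) : a < b := h.2.1

lemma const (h : Consec f a b) (hac : a ≤ c) (hcb : c < b) : f c = f a := h.2.2.2.2 c hac hcb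

lemma drops (h : Consec f a b) : Drops f b := ⟨by have := h.1; have := h.2.1; omega, h.2.2.2.1⟩

lemma drops_left (h : Consec f a b) (ha : 2 ≤ a) : Drops f a :=
  ⟨ha, h.2.2.1.resolve_left (by omega)⟩

lemma not_drops (h : Consec f a b) (hac : a < c) (hcb : c < b) : ¬ Drops f c := fun hc => by
  have h1 := h.const hac.le hcb
  have h2 := h.const (c := c - 1) (by omega) (by omega)
  have h3 := hc.2
  rw [h1, h2] at h3
  exact lt_irrefl _ h3

lemma value_lt (h : Consec f a b) : f b < f a := by
  have h1 := h.drops.2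
  rwa [h.const (c := b - 1) (by have := h.lt; omega) (by have := h.lt; omega)] at h1

lemma unique (h : Consec f a b) (h' : Consec f c d) {t : ℕ} (hat : a ≤ t) (htb : t < b)
    (hct : c ≤ t) (htd : t < d) : a = c ∧ b = d := by
  have h1 := h.one_le
  have h2 := h'.one_le
  have e1 : a = c := by
    rcases lt_trichotomy a c with h3 | h3 | h3
    · exact absurd (h'.drops_left (by omega)) (h.not_drops h3 (by omega))
    · exact h3
    · exact absurd (h.drops_left (by omega)) (h'.not_drops h3 (by omega))
  refine ⟨e1, ?_⟩
  rcases lt_trichotomy b d with h3 | h3 | h3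
  · exact absurd h.drops (h'.not_drops (by omega) h3)
  · exact h3
  · exact absurd h'.drops (h.not_drops (by omega) h3)

lemma left_unique (h : Consec f a b) (h' : Consec f c b) : a = c :=
  (h.unique h' (t := b - 1) (by have := h.lt; omega) (by have := h.lt; omega)
    (by have := h'.lt; omega) (by have := h.lt; omega)).1

/-- A drop beyond the left end is at or beyond the right end. -/
lemma le_of_drops (h : Consec f a b) (hc : Drops f c) (hac : a < c) : b ≤ c := by
  by_contra hcon
  exact h.not_drops hac (by omega) hc

lemma le_left_of_drops (h : Consec f a b) (hc : Drops f c) (hcb : c < b) : c ≤ a := by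
  by_contra hcon
  exact h.not_drops (by omega) hcb hc

end Consec

namespace IsStair

variable {f g : ℕ → ℝ} {a b c t : ℕ}

lemma exists_pred (hf : IsStair f) (h : Drops f b) : ∃ a, Consec f a b := by
  obtain ⟨a, b', h1, h2, h3⟩ := hf.exists_consec (b - 1) (by have := h.1; omega)
  have h4 := h1.le_of_drops h (by have := h.1; omega)
  have : b' = b := by have := h.1; omega
  exact ⟨a, this ▸ h1⟩

lemma exists_succ (hf : IsStair f) (h : Drops f a) : ∃ b, Consec f a b := by
  obtain ⟨a', b, h1, h2, h3⟩ := hf.exists_consec a (by have := h.1; omega)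
  have := h1.le_left_of_drops h h3
  have : a' = a := by omega
  exact ⟨b, this ▸ h1⟩

lemma three_term (hf : IsStair f) (h : Consec f a b) (h' : Consec f b c) {m : ℕ}
    (hc : c = m * b + a) : f a = m * f b + f c := by
  have h1 := hf.det a b h
  have h2 := hf.det b c h'
  have hb : (0 : ℝ) < b := by have := h.one_le; have := h.lt; exact_mod_cast (by omega : 0 < b)
  rw [hc] at h2
  rw [← hc] at h2
  have e : (c : ℝ) = m * b + a := by rw [hc]; push_cast; ring
  rw [e] at h2
  have : (b : ℝ) * (f a - (m * f b + f c)) = 0 := by linarith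
  rcases mul_eq_zero.1 this with h3 | h3
  · linarith
  · linarith

lemma add_le_of_consec (hf : IsStair f) (h : Consec f a b) (h' : Consec f b c) : a + b ≤ c := by
  obtain ⟨m, h1, h2⟩ := hf.recur a b c h h'
  nlinarith

lemma mul_right_lt_one (hf : IsStair f) (h : Consec f a b) : f a * b < 1 := by
  have h1 := hf.det a b h
  have h2 := hf.pos b (by have := h.one_le; have := h.lt; omega)
  have h3 : (0 : ℝ) < a := by exact_mod_cast h.one_le
  nlinarith

lemma mul_self_lt_one (hf : IsStair f) (ht : 1 ≤ t) : f t * t < 1 := by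
  obtain ⟨a, b, h, h1, h2⟩ := hf.exists_consec t ht
  rw [h.const h1 h2]
  have h3 := hf.mul_right_lt_one h
  have h4 := hf.pos a h.one_le
  have : (t : ℝ) < b := by exact_mod_cast h2
  nlinarith

lemma eq_of_not_drops (hf : IsStair f) (ha : 1 ≤ a) (hab : a ≤ b)
    (h : ∀ c, a < c → c ≤ b → ¬ Drops f c) : f b = f a := by
  induction b, hab using Nat.le_induction with
  | base => rfl
  | succ b hb ih =>
    rw [← ih fun c h1 h2 => h c h1 (by omega)]
    have h1 : ¬ Drops f (b + 1) := h _ (by omega) le_rfl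
    refine le_antisymm (hf.anti _ _ (by omega) (by omega)) (not_lt.1 fun h2 => h1 ⟨by omega, ?_⟩)
    simpa using h2

lemma exists_drops_gt (hf : IsStair f) (t : ℕ) : ∃ b, t < b ∧ Drops f b := by
  obtain ⟨a, b, h, h1, h2⟩ := hf.exists_consec (t + 1) (by omega)
  exact ⟨b, by omega, h.drops⟩

/-- Below a constant stretch of a larger function, a staircase drops at most once. -/
lemma not_two_drops (hf : IsStair f) (hg : IsStair g) {p p' p'' : ℕ} (hlt : g t < f t)
    (h : Consec f a b) (hat : a ≤ t) (htb : t < b) (h1 : Consec g p p') (hpt : p ≤ t)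
    (htp : t < p') (h2 : Consec g p' p'') : b < p'' := by
  by_contra hcon
  rw [h.const hat htb, h1.const hpt htp] at hlt
  have e1 := hg.det p p' h1
  have e2 := hf.mul_right_lt_one h
  have e3 := h1.value_lt
  have e4 : ((p + p' : ℕ) : ℝ) ≤ b := by
    have := hg.add_le_of_consec h1 h2
    exact_mod_cast (by omega : p + p' ≤ b)
  push_cast at e4
  have e5 := hf.pos a h.one_le
  have e6 : (0 : ℝ) < p := by exact_mod_cast h1.one_le
  have e7 : (0 : ℝ) < p' := by have := h1.lt; exact_mod_cast (by omega : 0 < p')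
  nlinarith

lemma not_drops_below (hf : IsStair f) (hg : IsStair g) {y y' : ℕ} (h : Consec f y y')
    (h1 : g y < f y) (h2 : g y' < f y') {c : ℕ} (hyc : y < c) (hcy : c ≤ y') : ¬ Drops g c := by
  intro hc
  obtain ⟨p, p', h3, h4, h5⟩ := hg.exists_consec y h.one_le
  have h6 : p' ≤ c := h3.le_of_drops hc (by omega)
  obtain ⟨p'', h7⟩ := hg.exists_succ h3.drops
  have h8 := hf.not_two_drops hg h1 h le_rfl h.lt h3 h4 h5 h7
  rw [h3.const h4 h5] at h1
  rw [h7.const (by omega) h8] at h2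
  have e1 := hf.det y y' h
  have e2 := hg.det p p' h3
  have e3 : (p : ℝ) ≤ y := by exact_mod_cast h4
  have e4 : (p' : ℝ) ≤ y' := by exact_mod_cast (by omega : p' ≤ y')
  have e5 : (0 : ℝ) < p := by exact_mod_cast h3.one_le
  have e6 : (0 : ℝ) < p' := by have := h3.lt; exact_mod_cast (by omega : 0 < p')
  have e7 := hg.pos p h3.one_le
  have e8 := hg.pos p' (by have := h3.lt; omega)
  nlinarith [mul_le_mul_of_nonneg_left e3 e8.le, mul_le_mul_of_nonneg_left e4 e7.le]

lemma chain_relation (hf : IsStair f) {z w : ℕ} (h : Consec f a z) (hzw : z ≤ w)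
    (h' : Consec f w t) : ∃ p q p' q' : ℕ, 1 ≤ p ∧ t = p * z + q * a ∧ w = p' * z + q' * a ∧
      f z = q * f w + q' * f t := by
  induction w using Nat.strong_induction_on generalizing t with
  | _ w ih =>
    rcases eq_or_lt_of_le hzw with rfl | hlt
    · obtain ⟨m, h1, h2⟩ := hf.recur a z t h h'
      exact ⟨m, 1, 1, 0, h1, by omega, by omega, by simp⟩
    · obtain ⟨x, hx⟩ := hf.exists_pred (h'.drops_left (by have := h.lt; have := h.one_le; omega))
      obtain ⟨p, q, p', q', h1, h2, h3, h4⟩ :=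
        ih x hx.lt (hx.le_left_of_drops h.drops hlt) hx
      obtain ⟨m, h5, h6⟩ := hf.recur x w t hx h'
      have h7 := hf.three_term hx h' h6
      refine ⟨m * p + p', m * q + q', p, q, by nlinarith, ?_, h2, ?_⟩
      · rw [h6, h2, h3]; ring
      · rw [h4, h7]; push_cast; ring

/-- If `f > g` on `[u, t)` and both drop at `t`, then `g` does not drop inside `(u, t)`. -/
lemma not_drops_of_gt (hf : IsStair f) (hg : IsStair g) {u : ℕ} (hu : 1 ≤ u)
    (hgt : ∀ v, u ≤ v → v < t → g v < f v) (hft : Drops f t) (hgt' : Drops g t) {d : ℕ}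
    (hud : u < d) (hdt : d < t) : ¬ Drops g d := by
  intro hd
  obtain ⟨c, hc⟩ := hg.exists_pred hgt'
  have huc : u < c := hud.trans_le (hc.le_left_of_drops hd hdt)
  obtain ⟨p₀, hp₀⟩ := hg.exists_pred (hc.drops_left (by omega))
  obtain ⟨w, hw⟩ := hf.exists_pred hft
  obtain ⟨p, p', h3, h4, h5⟩ := hg.exists_consec u hu
  obtain ⟨p'', h6⟩ := hg.exists_succ h3.drops
  have hct := hc.lt
  have hp'c : p' ≤ c := h3.le_of_drops hp₀.drops (by omega)
  have hp''t : p'' ≤ t := h6.le_of_drops hgt' (by omega)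
  rcases le_or_gt w u with hwu | huw
  · have := hf.not_two_drops hg (hgt u le_rfl (by omega)) hw hwu (by omega) h3 h4 h5 h6
    omega
  obtain ⟨a, z, haz, hau, huz⟩ := hf.exists_consec u hu
  have hwt := hw.lt
  have hzw : z ≤ w := haz.le_of_drops (hw.drops_left (by omega)) (by omega)
  have hcz : c ≤ z := by
    by_contra hcon
    obtain ⟨y, y', hy, hyc, hcy⟩ := hf.exists_consec (c - 1) (by omega)
    have hzy : z ≤ y := hy.le_left_of_drops haz.drops (by omega)
    have hy't : y' ≤ t := hy.le_of_drops hft (by omega)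
    have hgy := hgt y (by omega) (by omega)
    rcases eq_or_lt_of_le hy't with rfl | hlt
    · obtain ⟨r, r', h7, h8, h9⟩ := hg.exists_consec y (by omega)
      obtain ⟨r'', h10⟩ := hg.exists_succ h7.drops
      have h11 := hf.not_two_drops hg hgy hy le_rfl (by omega) h7 h8 h9 h10
      have h12 : r' ≤ c := h7.le_of_drops hp₀.drops (by omega)
      have h13 : r'' ≤ y' := h10.le_of_drops hgt' (by omega)
      omega
    · exact hf.not_drops_below hg hy hgy (hgt y' (by omega) hlt) (c := c) (by omega) (by omega)
        hp₀.drops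
  have hp'eq : p' = c := by
    by_contra hne
    have h7 : p'' ≤ c := h6.le_of_drops hp₀.drops (by omega)
    have := hf.not_two_drops hg (hgt u le_rfl (by omega)) haz hau huz h3 h4 h5 h6
    omega
  subst hp'eq
  have hpp := hp₀.left_unique h3
  subst hpp
  obtain ⟨m, hm1, hm⟩ := hg.recur _ _ _ hp₀ hc
  have g3 := hg.three_term hp₀ hc hm
  obtain ⟨P, q, P', q', hP1, hP, -, hfz⟩ := hf.chain_relation haz hzw hw
  have i1 : g p₀ < f a := by
    have := hgt u le_rfl (by omega)
    rwa [haz.const hau huz, hp₀.const h4 h5] at this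
  have i2 : g p' < f w := by
    have := hgt w (by omega) (by omega)
    rwa [hc.const (c := w) (by omega) (by omega)] at this
  have d1 := hf.det a z haz
  have d2 := hg.det p' t hc
  have ft := hf.pos t (by omega)
  have gt := hg.pos t (by omega)
  have gc := hg.pos p' (by omega)
  have hz0 : (0 : ℝ) < z := by exact_mod_cast (by omega : 0 < z)
  have ha0 : (0 : ℝ) ≤ a := by positivity
  have hq0 : (0 : ℝ) ≤ q := by positivity
  have hq'0 : (0 : ℝ) ≤ q' := by positivity
  have ht : (t : ℝ) = m * p' + p₀ := by rw [hm]; push_cast; ring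
  have hcz' : (p' : ℝ) ≤ z := by exact_mod_cast hcz
  have i3 : q * g p' ≤ f z := by
    rw [hfz]
    nlinarith [mul_le_mul_of_nonneg_left i2.le hq0, mul_nonneg hq'0 ft.le]
  have i4 : (m * g p' + g t) * z + q * g p' * a < 1 := by
    rw [← d1, ← g3]
    nlinarith [mul_lt_mul_of_pos_right i1 hz0, mul_le_mul_of_nonneg_right i3 ha0]
  have i5 : (m : ℝ) * z + q * a < m * p' + p₀ := by
    rw [← d2, ht] at i4
    by_contra hcon
    push Not at hcon
    nlinarith [mul_le_mul_of_nonneg_left hcz' gt.le, mul_le_mul_of_nonneg_left hcon gc.le]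
  have i5' : m * z + q * a < m * p' + p₀ := by exact_mod_cast i5
  have hlt := hp₀.lt
  rcases le_or_gt P m with h7 | h7
  · have := Nat.mul_le_mul_right z h7
    omega
  · have h8 := Nat.mul_le_mul h7 hcz
    have h9 : m.succ * p' = m * p' + p' := Nat.succ_mul m p'
    have h10 : 0 ≤ q * a := by positivity
    omega

/-- If `g` drops to a value below `f`, jumping at `t` together with `f`, then its previous drop is
where it fell below `f`. -/
lemma exists_crossing (hf : IsStair f) (hg : IsStair g) (hft : Drops f t) (hgt : Drops g t)
    (hlt : g (t - 1) < f (t - 1)) {v : ℕ} (hv : 1 ≤ v) (hvt : v < t) (hgv : f v < g v)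
    (hne : ∀ s, v ≤ s → s < t → f s ≠ g s) :
    ∃ a, v < a ∧ Consec g a t ∧ f (a - 1) < g (a - 1) ∧ ∀ s, a ≤ s → s < t → g s < f s := by
  classical
  have hex : ∃ j, f (t - 1 - j) < g (t - 1 - j) := ⟨t - 1 - v, by rwa [show t - 1 - (t - 1 - v) = v by omega]⟩
  have h1 := Nat.find_spec hex
  have h2 : Nat.find hex ≤ t - 1 - v :=
    Nat.find_min' hex (by rwa [show t - 1 - (t - 1 - v) = v by omega])
  have h3 : ∀ s, t - 1 - Nat.find hex < s → s < t → g s < f s := by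
    intro s hs hst
    have := Nat.find_min hex (m := t - 1 - s) (by omega)
    rw [show t - 1 - (t - 1 - s) = s by omega] at this
    exact lt_of_le_of_ne (not_lt.1 this) (hne s (by omega) hst).symm
  have h0 : Nat.find hex ≠ 0 := by
    intro h0
    rw [h0] at h1
    simp only [Nat.sub_zero] at h1
    exact lt_asymm h1 hlt
  generalize Nat.find hex = j at *
  obtain ⟨u, rfl⟩ : ∃ u, t - 1 - j = u := ⟨_, rfl⟩
  set u := t - 1 - j
  have hdu : Drops g (u + 1) := ⟨by omega, by
    have i1 := h3 (u + 1) (by omega) (by omega)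
    have i2 := hf.anti u (u + 1) (by omega) (by omega)
    simp only [Nat.add_sub_cancel]
    linarith⟩
  obtain ⟨b, hb⟩ := hg.exists_succ hdu
  have hbt : b = t := by
    have := hb.le_of_drops hgt (by omega)
    by_contra hcon
    exact hf.not_drops_of_gt hg (u := u + 1) (by omega) (fun v hv hvt => h3 v (by omega) hvt)
      hft hgt hb.lt (by omega) hb.drops
  exact ⟨u + 1, by omega, hbt ▸ hb, by simpa using h1, fun s hs hst => h3 s (by omega) hst⟩

lemma left_lt_of_gt (hf : IsStair f) (hg : IsStair g) {a' : ℕ} (h : Consec f a t)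
    (h' : Consec g a' t) (h1 : g a' < f a) (h2 : g t < f t) : a < a' := by
  by_contra hcon
  have e1 := hf.det a t h
  have e2 := hg.det a' t h'
  have e3 : (a' : ℝ) ≤ a := by exact_mod_cast (by omega : a' ≤ a)
  have e4 : (0 : ℝ) < t := by have := h.lt; exact_mod_cast (by omega : 0 < t)
  have e5 : (0 : ℝ) ≤ a' := by positivity
  have e6 := hf.pos t (by have := h.lt; omega)
  nlinarith [mul_lt_mul_of_pos_right h1 e4, mul_le_mul_of_nonneg_left e3 e6.le,
    mul_le_mul_of_nonneg_right h2.le e5]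

lemma consec_of_shared (hf : IsStair f) (hg : IsStair g) (h : Consec f a b) (h' : Consec g a b)
    {x y : ℕ} (hyb : y ≤ b) (hxy : Consec f x y) : Consec g x y := by
  induction b using Nat.strong_induction_on generalizing a with
  | _ b ih =>
    rcases eq_or_lt_of_le hyb with rfl | hlt
    · rwa [← h.left_unique hxy]
    · have hya := h.le_left_of_drops hxy.drops hlt
      have ha : 2 ≤ a := hxy.drops.1.trans hya
      obtain ⟨r, hr⟩ := hf.exists_pred (h.drops_left ha)
      obtain ⟨r', hr'⟩ := hg.exists_pred (h'.drops_left ha)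
      obtain ⟨m, -, hm⟩ := hf.recur _ _ _ hr h
      obtain ⟨m', -, hm'⟩ := hg.recur _ _ _ hr' h'
      have e1 : b % a = r := by
        rw [hm, Nat.add_comm, Nat.add_mul_mod_self_right, Nat.mod_eq_of_lt hr.lt]
      have e2 : b % a = r' := by
        rw [hm', Nat.add_comm, Nat.add_mul_mod_self_right, Nat.mod_eq_of_lt hr'.lt]
      rw [← e2, e1] at hr'
      exact ih a h.lt hr hr' hya

/-- Two eventually distinct staircases share only finitely many pairs of consecutive jumps. -/
lemma exists_unlinked (hf : IsStair f) (hg : IsStair g) {T : ℕ}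
    (hne : ∀ N, T ≤ N → f N ≠ g N) :
    ∃ T', ∀ a b, T' ≤ b → Consec f a b → ¬ Consec g a b := by
  by_contra hcon
  push Not at hcon
  have key : ∀ x y, Consec f x y ↔ Consec g x y := fun x y => by
    obtain ⟨a, b, h1, h2, h3⟩ := hcon y
    exact ⟨hf.consec_of_shared hg h2 h3 h1, hg.consec_of_shared hf h3 h2 h1⟩
  have hdrop : ∀ b, Drops f b ↔ Drops g b := fun b =>
    ⟨fun h => by obtain ⟨a, ha⟩ := hf.exists_pred h; exact ((key _ _).1 ha).drops,
      fun h => by obtain ⟨a, ha⟩ := hg.exists_pred h; exact ((key _ _).2 ha).drops⟩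
  set S := T + 1
  have hδ : 0 < |f S - g S| := abs_pos.2 (sub_ne_zero.2 (hne S (by omega)))
  have hind : ∀ N, S ≤ N → |f S - g S| ≤ |f N - g N| := by
    intro N hN
    induction N, hN using Nat.le_induction with
    | base => exact le_rfl
    | succ N hN ih =>
      refine ih.trans ?_
      by_cases hd : Drops f (N + 1)
      · obtain ⟨c, hc⟩ := hf.exists_pred hd
        have hc' := (key _ _).1 hc
        have hcN := hc.lt
        rw [hc.const (c := N) (by omega) (by omega), hc'.const (c := N) (by omega) (by omega)]
        have e1 := hf.det _ _ hc
        have e2 := hg.det _ _ hc'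
        have hc0 : (0 : ℝ) < c := by exact_mod_cast hc.one_le
        have e3 : (f (N + 1) - g (N + 1)) * c = -((f c - g c) * (N + 1 : ℕ)) := by linarith
        have e4 : |f (N + 1) - g (N + 1)| * c = |f c - g c| * (N + 1 : ℕ) := by
          have := congrArg abs e3
          rwa [abs_neg, abs_mul, abs_mul, Nat.abs_cast, Nat.abs_cast] at this
        have e5 : (c : ℝ) ≤ (N + 1 : ℕ) := by exact_mod_cast hcN.le
        have e6 := mul_le_mul_of_nonneg_left e5 (abs_nonneg (f c - g c))
        rw [← e4] at e6
        exact le_of_mul_le_mul_right e6 hc0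
      · have e1 := hf.eq_of_not_drops (a := N) (b := N + 1) (by omega) (by omega)
          fun c h1 h2 => by rwa [show c = N + 1 by omega]
        have e2 := hg.eq_of_not_drops (a := N) (b := N + 1) (by omega) (by omega)
          fun c h1 h2 => by rwa [show c = N + 1 by omega, ← hdrop]
        rw [e1, e2]
  obtain ⟨N, hN⟩ := exists_nat_gt (1 / |f S - g S|)
  have h1 := hind (max N S) (le_max_right _ _)
  have h2 := hf.mul_self_lt_one (t := max N S) (by omega)
  have h3 := hg.mul_self_lt_one (t := max N S) (by omega)
  have h4 := hf.pos (max N S) (by omega)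
  have h5 := hg.pos (max N S) (by omega)
  have h6 : (N : ℝ) ≤ (max N S : ℕ) := by exact_mod_cast le_max_left _ _
  rw [div_lt_iff₀ hδ] at hN
  have h7 : |f (max N S) - g (max N S)| * (max N S : ℕ) < 1 := by
    rcases abs_cases (f (max N S) - g (max N S)) with ⟨h8, -⟩ | ⟨h8, -⟩ <;> rw [h8] <;>
      nlinarith
  nlinarith

/-- No staircase stays above another one forever. -/
lemma exists_not_gt (hf : IsStair f) (hg : IsStair g) (T : ℕ) : ∃ N, T ≤ N ∧ f N ≤ g N := by
  by_contra! hcon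
  obtain ⟨y, hy, hyd⟩ := hf.exists_drops_gt T
  obtain ⟨c, hyc, hcd⟩ := hg.exists_drops_gt y
  obtain ⟨x, x', hx, h1, h2⟩ := hf.exists_consec (c - 1) (by omega)
  have h3 := hx.le_left_of_drops hyd (by omega)
  exact hf.not_drops_below hg hx (hcon x (by omega)) (hcon x' (by omega)) (c := c) (by omega)
    (by omega) hcd

end IsStair

/-- A family of `n = k (k + 1) / 2` staircases whose eventual relative orders form the set `R` of
cardinality `k`. -/
structure StairSys (n k : ℕ) where
  f : Fin n → ℕ → ℝ
  stair : ∀ i, IsStair (f i)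
  two_le : 2 ≤ k
  card_eq : n = (k + 1).choose 2
  T₁ : ℕ
  T₂ : ℕ
  one_le : 1 ≤ T₁
  ne : ∀ N, T₁ ≤ N → ∀ i j, i ≠ j → f i N ≠ f j N
  R : Finset (Fin n → Fin n → Prop)
  card_R : R.card = k
  mem_R : ∀ N, T₁ ≤ N → (fun i j => f i N < f j N) ∈ R
  occurs : ∀ P ∈ R, ∃ N, T₁ ≤ N ∧ N < T₂ ∧ (fun i j => f i N < f j N) = P
  occurs_inf : ∀ P ∈ R, ∀ T, ∃ N, T ≤ N ∧ (fun i j => f i N < f j N) = P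
  unlinked : ∀ i j, i ≠ j → ∀ a b, T₁ ≤ b → Consec (f i) a b → ¬ Consec (f j) a b

namespace StairSys

variable {n k : ℕ} (S : StairSys n k)

/-- The relative order at time `N`. -/
def X (N : ℕ) : Fin n → Fin n → Prop := fun i j => S.f i N < S.f j N

open Classical in
/-- The relative orders occurring in `[t, s)`. -/
noncomputable def perms (t s : ℕ) : Finset (Fin n → Fin n → Prop) := (Finset.Ico t s).image S.X

/-- All orders in `A` agree on `Q`. -/
def Chain (A : Finset (Fin n → Fin n → Prop)) (Q : Finset (Fin n)) : Prop :=
  ∀ i ∈ Q, ∀ j ∈ Q, ∀ P ∈ A, ∀ P' ∈ A, P i j → P' i j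

open Classical in
/-- The elements of `Q` falling below another element of `Q` at time `s`. -/
noncomputable def Los (Q : Finset (Fin n)) (s : ℕ) : Finset (Fin n) :=
  Q.filter fun i => ∃ j ∈ Q, S.f j (s - 1) < S.f i (s - 1) ∧ S.f i s < S.f j s

/-- `a < s` are consecutive jumps of `f j`, at the first of which `f j` falls below `f i`, staying
there until `s`. -/
structure Edge (j i : Fin n) (a s : ℕ) : Prop where
  lt : S.T₁ < a
  consec : Consec (S.f j) a s
  before : S.f i (a - 1) < S.f j (a - 1)
  after : ∀ v, a ≤ v → v < s → S.f j v < S.f i v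

/-- `a < s` are consecutive jumps of `f j`, and the order preceding `a` does not occur in
`[a, s)`. -/
structure Ed (j : Fin n) (a s : ℕ) : Prop where
  lt : S.T₁ < a
  consec : Consec (S.f j) a s
  notMem : S.X (a - 1) ∉ S.perms a s

variable {S}

lemma X_mem {N : ℕ} (h : S.T₁ ≤ N) : S.X N ∈ S.R := S.mem_R N h

lemma mem_perms {t s : ℕ} {P : Fin n → Fin n → Prop} :
    P ∈ S.perms t s ↔ ∃ v, t ≤ v ∧ v < s ∧ S.X v = P := by
  simp [perms, and_assoc]

lemma X_mem_perms {t s v : ℕ} (h1 : t ≤ v) (h2 : v < s) : S.X v ∈ S.perms t s :=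
  mem_perms.2 ⟨v, h1, h2, rfl⟩

lemma perms_mono {t t' s s' : ℕ} (h1 : t' ≤ t) (h2 : s ≤ s') : S.perms t s ⊆ S.perms t' s' := by
  intro P hP
  obtain ⟨v, h3, h4, h5⟩ := mem_perms.1 hP
  exact mem_perms.2 ⟨v, by omega, by omega, h5⟩

lemma perms_subset {t s : ℕ} (h : S.T₁ ≤ t) : S.perms t s ⊆ S.R := by
  intro P hP
  obtain ⟨v, h3, h4, rfl⟩ := mem_perms.1 hP
  exact X_mem (by omega)

lemma card_perms_le {t s : ℕ} (h : S.T₁ ≤ t) : (S.perms t s).card ≤ k :=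
  (Finset.card_le_card (perms_subset h)).trans_eq S.card_R

lemma perms_eq_R {t s : ℕ} (h : S.T₁ ≤ t) (hc : k ≤ (S.perms t s).card) : S.perms t s = S.R :=
  Finset.eq_of_subset_of_card_le (perms_subset h) (S.card_R.trans_le hc)

open Classical in
lemma perms_succ {t s : ℕ} (h : t ≤ s) : S.perms t (s + 1) = insert (S.X s) (S.perms t s) := by
  unfold perms
  rw [← Finset.image_insert]
  congr 1
  ext v
  simp only [Finset.mem_Ico, Finset.mem_insert]
  omega

lemma perms_succ_of_mem {t s : ℕ} (h : t ≤ s) (hm : S.X s ∈ S.perms t s) :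
    S.perms t (s + 1) = S.perms t s := by
  classical
  rw [perms_succ h, Finset.insert_eq_of_mem hm]

lemma card_perms_succ {t s : ℕ} (h : t ≤ s) (hm : S.X s ∉ S.perms t s) :
    (S.perms t (s + 1)).card = (S.perms t s).card + 1 := by
  classical
  rw [perms_succ h, Finset.card_insert_of_notMem hm]

lemma T₁_lt_T₂ : S.T₁ < S.T₂ := by
  obtain ⟨P, hP⟩ := Finset.card_pos.1 (show 0 < S.R.card by
    rw [S.card_R]; have := S.two_le; omega)
  obtain ⟨N, h1, h2, -⟩ := S.occurs P hP
  omega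

lemma lt_or_gt {N : ℕ} (hN : S.T₁ ≤ N) {i j : Fin n} (hij : i ≠ j) :
    S.f i N < S.f j N ∨ S.f j N < S.f i N := lt_or_gt_of_ne (S.ne N hN i j hij)

lemma exists_rel {i j : Fin n} (hij : i ≠ j) : ∃ P ∈ S.R, P i j := by
  obtain ⟨N, h1, h2⟩ := (S.stair j).exists_not_gt (S.stair i) S.T₁
  obtain ⟨N, h1, h2⟩ := (S.stair i).exists_not_gt (S.stair j) S.T₁
  exact ⟨_, S.mem_R N h1, lt_of_le_of_ne h2 (S.ne N h1 i j hij)⟩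

lemma exists_edge {i j : Fin n} {s : ℕ} (hs : S.T₂ < s) (hi : Drops (S.f i) s)
    (hj : Drops (S.f j) s) (hlt : S.f j (s - 1) < S.f i (s - 1)) : ∃ a, S.Edge j i a s := by
  have hij : i ≠ j := by rintro rfl; exact lt_irrefl _ hlt
  obtain ⟨P, hP, hPij⟩ := exists_rel hij
  obtain ⟨v, h1, h2, rfl⟩ := S.occurs P hP
  have := S.one_le
  obtain ⟨a, h3, h4, h5, h6⟩ := (S.stair i).exists_crossing (S.stair j) hi hj hlt (v := v)
    (by omega) (by omega) hPij fun s h1' h2' => S.ne s (by omega) i j hij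
  exact ⟨a, by omega, h4, h5, h6⟩

lemma Edge.ne {i j : Fin n} {a s : ℕ} (h : S.Edge j i a s) : j ≠ i := by
  rintro rfl
  exact lt_irrefl _ h.before

lemma Edge.ed {i j : Fin n} {a s : ℕ} (h : S.Edge j i a s) : S.Ed j a s := by
  refine ⟨h.lt, h.consec, fun hm => ?_⟩
  obtain ⟨v, h1, h2, h3⟩ := mem_perms.1 hm
  have h4 := h.after v h1 h2
  have h5 : S.X v i j := h3 ▸ h.before
  exact lt_asymm h4 h5

lemma Ed.X_mem {j : Fin n} {a s : ℕ} (h : S.Ed j a s) : S.X (a - 1) ∈ S.R :=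
  StairSys.X_mem (by have := h.lt; omega)

lemma Ed.unique {j j' : Fin n} {a a' s : ℕ} (h : S.Ed j a s) (h' : S.Ed j' a' s)
    (hX : S.X (a - 1) = S.X (a' - 1)) : j = j' ∧ a = a' := by
  have key : ∀ {j j' : Fin n} {a a' s : ℕ}, S.Ed j a s → S.Ed j' a' s →
      S.X (a - 1) = S.X (a' - 1) → ¬ a < a' := by
    intro j j' a a' s h h' hX hlt
    have := h'.consec.lt
    exact h.notMem (mem_perms.2 ⟨a' - 1, by omega, by omega, hX.symm⟩)
  have e : a = a' := by
    have h1 := key h h' hX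
    have h2 := key h' h hX.symm
    omega
  subst e
  refine ⟨by_contra fun hne => ?_, rfl⟩
  exact S.unlinked j j' hne a s (by have := h.lt; have := h.consec.lt; omega) h.consec h'.consec

lemma Chain.mono {A A' : Finset (Fin n → Fin n → Prop)} {Q Q' : Finset (Fin n)} (h : Chain A Q)
    (hA : A' ⊆ A) (hQ : Q' ⊆ Q) : Chain A' Q' := fun i hi j hj P hP P' hP' =>
  h i (hQ hi) j (hQ hj) P (hA hP) P' (hA hP')

lemma exists_max (Q : Finset (Fin n)) (hQ : Q.Nonempty) {N : ℕ} (hN : S.T₁ ≤ N) :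
    ∃ i₀ ∈ Q, ∀ j ∈ Q, j ≠ i₀ → S.f j N < S.f i₀ N := by
  obtain ⟨i₀, h1, h2⟩ := Q.exists_max_image (fun i => S.f i N) hQ
  exact ⟨i₀, h1, fun j hj hne => lt_of_le_of_ne (h2 j hj) (S.ne N hN j i₀ hne)⟩

/-- If the members of a chain of `[t, s)` all drop at `s`, each of them except the top one
determines an order not occurring in `[t, s)`. -/
lemma drop_chain {t s : ℕ} (hts : t < s) (ht : S.T₁ ≤ t) (hs : S.T₂ < s) {Q : Finset (Fin n)}
    (hQ : Q.Nonempty) (hd : ∀ j ∈ Q, Drops (S.f j) s) (hc : Chain (S.perms t s) Q) :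
    ∃ i₀ ∈ Q, (∀ j ∈ Q, j ≠ i₀ → S.f j (s - 1) < S.f i₀ (s - 1) ∧ ∃ a ≤ t, S.Edge j i₀ a s) ∧
      Q.card + (S.perms t s).card ≤ k + 1 ∧
      (k + 1 ≤ Q.card + (S.perms t s).card → ∀ W ∈ S.R, W ∉ S.perms t s →
        ∃ j ∈ Q, j ≠ i₀ ∧ ∃ a ≤ t, S.Edge j i₀ a s ∧ S.X (a - 1) = W) := by
  classical
  obtain ⟨i₀, hi₀, hmax⟩ := S.exists_max Q hQ (N := s - 1) (by omega)
  have hedge : ∀ j ∈ Q, j ≠ i₀ → ∃ a ≤ t, S.Edge j i₀ a s := by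
    intro j hj hne
    obtain ⟨a, ha⟩ := exists_edge hs (hd i₀ hi₀) (hd j hj) (hmax j hj hne)
    refine ⟨a, ?_, ha⟩
    by_contra hlt
    have h1 := ha.consec.lt
    have h2 := hc j hj i₀ hi₀ _ (X_mem_perms (by omega) (by omega : s - 1 < s)) _
      (X_mem_perms (by omega) (by omega : a - 1 < s)) (hmax j hj hne)
    exact lt_asymm h2 ha.before
  choose! a hat ha using hedge
  have hsub : (Q.erase i₀).image (fun j => S.X (a j - 1)) ⊆ S.R \ S.perms t s := by
    intro W hW
    obtain ⟨j, hj, rfl⟩ := Finset.mem_image.1 hW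
    obtain ⟨hj1, hj2⟩ := Finset.mem_erase.1 hj
    have h1 := (ha j hj2 hj1).ed
    exact Finset.mem_sdiff.2 ⟨h1.X_mem, fun h2 => h1.notMem (perms_mono (hat j hj2 hj1) le_rfl h2)⟩
  have hcard : ((Q.erase i₀).image (fun j => S.X (a j - 1))).card = Q.card - 1 := by
    rw [Finset.card_image_of_injOn, Finset.card_erase_of_mem hi₀]
    intro j hj j' hj' he
    obtain ⟨hj1, hj2⟩ := Finset.mem_erase.1 hj
    obtain ⟨hj1', hj2'⟩ := Finset.mem_erase.1 hj'
    exact ((ha j hj2 hj1).ed.unique (ha j' hj2' hj1').ed he).1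
  have hcard' : (S.R \ S.perms t s).card = k - (S.perms t s).card := by
    rw [Finset.card_sdiff_of_subset (perms_subset ht), S.card_R]
  have hle := Finset.card_le_card hsub
  rw [hcard, hcard'] at hle
  have hpk := S.card_perms_le (s := s) ht
  have hQ1 := hQ.card_pos
  refine ⟨i₀, hi₀, fun j hj hne => ⟨hmax j hj hne, a j, hat j hj hne, ha j hj hne⟩, by omega, ?_⟩
  intro hge W hW hWn
  have heq := Finset.eq_of_subset_of_card_le hsub (by rw [hcard, hcard']; omega)
  have hWm : W ∈ S.R \ S.perms t s := Finset.mem_sdiff.2 ⟨hW, hWn⟩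
  rw [← heq] at hWm
  obtain ⟨j, hj, rfl⟩ := Finset.mem_image.1 hWm
  obtain ⟨hj1, hj2⟩ := Finset.mem_erase.1 hj
  exact ⟨j, hj2, hj1, a j, hat j hj2 hj1, ha j hj2 hj1, rfl⟩

lemma mem_Los {Q : Finset (Fin n)} {s : ℕ} {i : Fin n} :
    i ∈ S.Los Q s ↔ i ∈ Q ∧ ∃ j ∈ Q, S.f j (s - 1) < S.f i (s - 1) ∧ S.f i s < S.f j s := by
  simp [Los]

lemma Los_subset {Q : Finset (Fin n)} {s : ℕ} : S.Los Q s ⊆ Q := fun _ h => (mem_Los.1 h).1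

lemma drops_of_mem_Los {Q : Finset (Fin n)} {s : ℕ} (hs : 2 ≤ s) {i : Fin n}
    (h : i ∈ S.Los Q s) : Drops (S.f i) s := by
  obtain ⟨-, j, -, h1, h2⟩ := mem_Los.1 h
  refine ⟨hs, ?_⟩
  have := (S.stair j).anti (s - 1) s (by omega) (by omega)
  linarith

lemma chain_sdiff_Los {t s : ℕ} (ht : S.T₁ ≤ t) (hts : t < s) {Q : Finset (Fin n)}
    (hc : Chain (S.perms t s) Q) : Chain (S.perms t (s + 1)) (Q \ S.Los Q s) := by
  have key : ∀ i ∈ Q \ S.Los Q s, ∀ j ∈ Q \ S.Los Q s, ∀ P ∈ S.perms t (s + 1),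
      P i j ↔ S.X (s - 1) i j := by
    intro i hi j hj P hP
    obtain ⟨hi1, hi2⟩ := Finset.mem_sdiff.1 hi
    obtain ⟨hj1, hj2⟩ := Finset.mem_sdiff.1 hj
    have hs1 : S.X (s - 1) ∈ S.perms t s := X_mem_perms (by omega) (by omega)
    obtain ⟨v, h1, h2, rfl⟩ := mem_perms.1 hP
    rcases eq_or_lt_of_le (by omega : v ≤ s) with rfl | hvs
    · by_cases hij : i = j
      · subst hij
        exact ⟨fun h => absurd h (lt_irrefl _), fun h => absurd h (lt_irrefl _)⟩
      constructor
      · intro h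
        rcases lt_or_gt (S := S) (N := v - 1) (by omega) hij with h3 | h3
        · exact h3
        · exact absurd (mem_Los.2 ⟨hi1, j, hj1, h3, h⟩) hi2
      · intro h
        rcases lt_or_gt (S := S) (N := v) (by omega) hij with h3 | h3
        · exact h3
        · exact absurd (mem_Los.2 ⟨hj1, i, hi1, h, h3⟩) hj2
    · exact ⟨hc i hi1 j hj1 _ (X_mem_perms h1 hvs) _ hs1,
        hc i hi1 j hj1 _ hs1 _ (X_mem_perms h1 hvs)⟩
  intro i hi j hj P hP P' hP' h
  exact (key i hi j hj P' hP').2 ((key i hi j hj P hP).1 h)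

lemma exists_new {t s : ℕ} (hlt : (S.perms t s).card < k) :
    ∃ s₁, s ≤ s₁ ∧ S.perms t s₁ = S.perms t s ∧ S.X s₁ ∉ S.perms t s := by
  classical
  obtain ⟨P, hP, hPn⟩ := Finset.exists_mem_notMem_of_card_lt_card (by rwa [S.card_R])
    (s := S.perms t s) (t := S.R)
  obtain ⟨N, h1, rfl⟩ := S.occurs_inf P hP s
  have hex : ∃ N, s ≤ N ∧ S.X N ∉ S.perms t s := ⟨N, h1, hPn⟩
  obtain ⟨h2, h3⟩ := Nat.find_spec hex
  refine ⟨Nat.find hex, h2, ?_, h3⟩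
  refine Finset.Subset.antisymm (fun P hP => ?_) (perms_mono le_rfl h2)
  obtain ⟨v, h4, h5, rfl⟩ := mem_perms.1 hP
  by_contra hcon
  rcases lt_or_ge v s with h6 | h6
  · exact hcon (X_mem_perms h4 h6)
  · exact Nat.find_min hex h5 ⟨h6, hcon⟩

lemma card_chain_R_le {Q : Finset (Fin n)} (hc : Chain S.R Q) : Q.card ≤ 1 := by
  rw [Finset.card_le_one]
  intro i hi j hj
  by_contra hij
  obtain ⟨P, hP, h1⟩ := exists_rel (S := S) hij
  obtain ⟨P', hP', h2⟩ := exists_rel (S := S) (Ne.symm hij)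
  have h3 := hc i hi j hj P hP P' hP' h1
  obtain ⟨N, -, -, rfl⟩ := S.occurs P' hP'
  exact lt_asymm h2 h3

lemma card_Los_sdiff (Q : Finset (Fin n)) (s : ℕ) :
    (S.Los Q s).card + (Q \ S.Los Q s).card = Q.card := by
  rw [add_comm]
  exact Finset.card_sdiff_add_card_eq_card Los_subset

lemma card_chain_le (d : ℕ) : ∀ {t s : ℕ} {Q : Finset (Fin n)}, S.T₂ ≤ t → t < s →
    Chain (S.perms t s) Q → (S.perms t s).card + d = k → Q.card ≤ (d + 2).choose 2 := by
  have hT := S.T₁_lt_T₂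
  have h1T := S.one_le
  induction d with
  | zero =>
    intro t s Q ht hts hc hd
    rw [perms_eq_R (by omega) (by omega)] at hc
    simpa using card_chain_R_le hc
  | succ d ih =>
    intro t s Q ht hts hc hd
    obtain ⟨s₁, h1, h2, h3⟩ := exists_new (S := S) (t := t) (s := s)
      (by omega)
    rw [← h2] at hc hd h3
    have h4 := ih ht (by omega : t < s₁ + 1) (chain_sdiff_Los (by omega) (by omega) hc)
      (by rw [card_perms_succ (by omega) h3]; omega)
    have h5 : (S.Los Q s₁).card ≤ d + 2 := by
      rcases (S.Los Q s₁).eq_empty_or_nonempty with h6 | h6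
      · simp [h6]
      · obtain ⟨-, -, -, h7, -⟩ := drop_chain (by omega : t < s₁) (by omega) (by omega) h6
          (fun j hj => drops_of_mem_Los (by omega) hj) (hc.mono subset_rfl Los_subset)
        omega
    have h6 := card_Los_sdiff (S := S) Q s₁
    have h7 : (d + 1 + 2).choose 2 = (d + 2) + (d + 2).choose 2 := by
      rw [show d + 1 + 2 = (d + 2) + 1 by omega, Nat.choose_succ_succ' (d + 2) 1]; simp
    omega

/-- A greedily built large chain. -/
lemma exists_large_chain {t s : ℕ} (ht : S.T₂ ≤ t) (hts : t < s) :
    ∃ Q : Finset (Fin n), Chain (S.perms t s) Q ∧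
      (k - (S.perms t s).card + 2).choose 2 ≤ Q.card ∧
      ∀ s₁, t < s₁ → s₁ < s → S.X s₁ ∉ S.perms t s₁ → ∀ j ∈ Q, ∀ a ≤ t, ¬ S.Ed j a s₁ := by
  have hT := S.T₁_lt_T₂
  have h1T := S.one_le
  induction s, hts using Nat.le_induction with
  | base =>
    have hp : S.perms t (t + 1) = {S.X t} := by simp [perms]
    refine ⟨Finset.univ, ?_, ?_, ?_⟩
    · rw [hp]
      intro i _ j _ P hP P' hP' h
      rw [Finset.mem_singleton] at hP hP'
      rwa [hP', ← hP]
    · rw [hp, Finset.card_singleton, Finset.card_univ, Fintype.card_fin, S.card_eq]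
      have := S.two_le
      rw [show k - 1 + 2 = k + 1 by omega]
    · intro s₁ h1 h2; omega
  | succ s hs ih =>
    obtain ⟨Q, hc, hQ, hEd⟩ := ih
    by_cases hm : S.X s ∈ S.perms t s
    · rw [perms_succ_of_mem (by omega) hm]
      refine ⟨Q, hc, hQ, fun s₁ h1 h2 h3 => ?_⟩
      rcases eq_or_lt_of_le (by omega : s₁ ≤ s) with rfl | h4
      · exact absurd hm h3
      · exact hEd s₁ h1 h4 h3
    · have hk1 := card_perms_succ (by omega : t ≤ s) hm
      have hk2 := S.card_perms_le (t := t) (s := s + 1) (by omega)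
      obtain ⟨d, hd⟩ : ∃ d, (S.perms t s).card + (d + 1) = k :=
        ⟨k - (S.perms t s).card - 1, by omega⟩
      have hc' := chain_sdiff_Los (by omega) (by omega : t < s) hc
      have h4 := card_chain_le d ht (by omega : t < s + 1) hc' (by omega)
      have h6 := card_Los_sdiff (S := S) Q s
      have h7 : (d + 1 + 2).choose 2 = (d + 2) + (d + 2).choose 2 := by
        rw [show d + 1 + 2 = (d + 2) + 1 by omega, Nat.choose_succ_succ' (d + 2) 1]; simp
      rw [show k - (S.perms t s).card + 2 = d + 1 + 2 by omega] at hQ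
      have hne : (S.Los Q s).Nonempty := Finset.card_pos.1 (by omega)
      obtain ⟨i₀, -, -, h8, h9⟩ := drop_chain (by omega : t < s) (by omega) (by omega) hne
          (fun j hj => drops_of_mem_Los (by omega) hj) (hc.mono subset_rfl Los_subset)
      refine ⟨Q \ S.Los Q s, hc', ?_, ?_⟩
      · rw [show k - (S.perms t (s + 1)).card + 2 = d + 2 by omega]; omega
      · intro s₁ h1 h2 h3 j hj a hat hed
        obtain ⟨hj1, hj2⟩ := Finset.mem_sdiff.1 hj
        rcases eq_or_lt_of_le (by omega : s₁ ≤ s) with rfl | h10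
        · obtain ⟨j', hj', -, a', -, ha', hX⟩ := h9 (by omega) _ hed.X_mem
            fun h => hed.notMem (perms_mono hat le_rfl h)
          obtain ⟨rfl, -⟩ := ha'.ed.unique hed hX
          exact hj2 hj'
        · exact hEd s₁ h1 h10 h3 j hj1 a hat hed

lemma card_chain_le_of_not_ed (d : ℕ) : ∀ {t s : ℕ} {Q : Finset (Fin n)}, S.T₂ ≤ t → t < s →
    Chain (S.perms t s) Q → (S.perms t s).card + d = k →
    (∀ s₁, s ≤ s₁ → S.X s₁ ∉ S.perms t s₁ → ∀ j ∈ Q, ∀ a ≤ t, ¬ S.Ed j a s₁) →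
    Q.card ≤ d + 1 := by
  have hT := S.T₁_lt_T₂
  have h1T := S.one_le
  induction d with
  | zero =>
    intro t s Q ht hts hc hd _
    rw [perms_eq_R (by omega) (by omega)] at hc
    simpa using card_chain_R_le hc
  | succ d ih =>
    intro t s Q ht hts hc hd hEd
    obtain ⟨s₁, h1, h2, h3⟩ := exists_new (S := S) (t := t) (s := s)
      (by omega)
    rw [← h2] at hc hd h3
    have h4 := ih ht (by omega : t < s₁ + 1) (chain_sdiff_Los (by omega) (by omega) hc)
      (by rw [card_perms_succ (by omega) h3]; omega)
      fun s₂ h5 h6 j hj => hEd s₂ (by omega) h6 j (Finset.mem_sdiff.1 hj).1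
    have h5 : (S.Los Q s₁).card ≤ 1 := by
      rcases (S.Los Q s₁).eq_empty_or_nonempty with h6 | h6
      · simp [h6]
      · obtain ⟨i₀, -, h7, -, -⟩ := drop_chain (by omega : t < s₁) (by omega) (by omega) h6
          (fun j hj => drops_of_mem_Los (by omega) hj) (hc.mono subset_rfl Los_subset)
        refine Finset.card_le_one.2 fun i hi j hj => ?_
        have key : ∀ j ∈ S.Los Q s₁, j = i₀ := fun j hj => by
          by_contra hne
          obtain ⟨-, a, hat, ha⟩ := h7 j hj hne
          exact hEd s₁ h1 h3 j (Los_subset hj) a hat ha.ed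
        rw [key i hi, key j hj]
    have h6 := card_Los_sdiff (S := S) Q s₁
    omega

end StairSys

lemma exists_first_switch {p : ℕ → Prop} {u w : ℕ} (hu : p u) (hw : ¬ p w) (huw : u ≤ w) :
    ∃ v, u < v ∧ v ≤ w ∧ ¬ p v ∧ ∀ x, u ≤ x → x < v → p x := by
  classical
  have hex : ∃ v, u ≤ v ∧ ¬ p v := ⟨w, huw, hw⟩
  obtain ⟨h1, h2⟩ := Nat.find_spec hex
  refine ⟨Nat.find hex, lt_of_le_of_ne h1 fun h => ?_, Nat.find_min' hex ⟨huw, hw⟩, h2, ?_⟩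
  · rw [← h] at h2; exact h2 hu
  · intro x h3 h4
    by_contra h5
    exact Nat.find_min hex h4 ⟨h3, h5⟩

lemma exists_last_switch {X : Type*} {x : ℕ → X} {a w : ℕ} (ha : x (a - 1) ≠ x a)
    (haw : a ≤ w) : ∃ s, a ≤ s ∧ s ≤ w ∧ x (s - 1) ≠ x s ∧ ∀ v, s ≤ v → v ≤ w → x v = x w := by
  induction w, haw using Nat.le_induction with
  | base => exact ⟨a, le_rfl, le_rfl, ha, fun v h1 h2 => by rw [le_antisymm h2 h1]⟩
  | succ w hw ih =>
    by_cases h : x w = x (w + 1)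
    · obtain ⟨s, h1, h2, h3, h4⟩ := ih
      refine ⟨s, h1, by omega, h3, fun v h5 h6 => ?_⟩
      rcases eq_or_lt_of_le h6 with rfl | h7
      · rfl
      · rw [h4 v h5 (by omega), h]
    · refine ⟨w + 1, by omega, le_rfl, by simpa using h, fun v h5 h6 => ?_⟩
      rw [le_antisymm h6 h5]

namespace StairSys

variable {n k : ℕ} {S : StairSys n k}

/-- The losers at a moment of change. -/
noncomputable def L (S : StairSys n k) (s : ℕ) : Finset (Fin n) := S.Los Finset.univ s

lemma mem_L {s : ℕ} {i : Fin n} :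
    i ∈ S.L s ↔ ∃ j, S.f j (s - 1) < S.f i (s - 1) ∧ S.f i s < S.f j s := by
  simp [L, mem_Los]

lemma drops_of_mem_L {s : ℕ} (hs : 2 ≤ s) {i : Fin n} (h : i ∈ S.L s) : Drops (S.f i) s :=
  drops_of_mem_Los hs h

lemma X_pred_ne_of_mem_L {s : ℕ} {i : Fin n} (h : i ∈ S.L s) : S.X (s - 1) ≠ S.X s := by
  intro he
  obtain ⟨j, h1, h2⟩ := mem_L.1 h
  have h3 : S.X (s - 1) j i := h1
  rw [he] at h3
  exact lt_asymm h2 h3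

lemma L_nonempty {s : ℕ} (hs : S.T₁ < s) (h : S.X (s - 1) ≠ S.X s) : (S.L s).Nonempty := by
  by_contra hcon
  rw [Finset.not_nonempty_iff_eq_empty] at hcon
  refine h (funext fun i => funext fun j => propext ?_)
  by_cases hij : i = j
  · subst hij
    exact ⟨fun h => absurd h (lt_irrefl _), fun h => absurd h (lt_irrefl _)⟩
  constructor
  · intro h1
    rcases lt_or_gt (S := S) (N := s) (by omega) hij with h2 | h2
    · exact h2
    · have : j ∈ S.L s := mem_L.2 ⟨i, h1, h2⟩
      simp [hcon] at this
  · intro h1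
    rcases lt_or_gt (S := S) (N := s - 1) (by omega) hij with h2 | h2
    · exact h2
    · have : i ∈ S.L s := mem_L.2 ⟨j, h2, h1⟩
      simp [hcon] at this

lemma Edge.mem_L {i j : Fin n} {a s : ℕ} (h : S.Edge j i a s) : j ∈ S.L a :=
  StairSys.mem_L.2 ⟨i, h.before, h.after a le_rfl h.consec.lt⟩

lemma trans_aux {s : ℕ} (hs : S.T₂ < s) (h : S.X (s - 1) ≠ S.X s) :
    (S.L s).card = k ∧ ∃ i₀ ∈ S.L s,
      (∀ j ∈ S.L s, j ≠ i₀ → S.f j (s - 1) < S.f i₀ (s - 1) ∧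
        ∃ a, S.Edge j i₀ a s ∧ S.X (a - 1) ≠ S.X (s - 1)) ∧
      ∀ W ∈ S.R, W ≠ S.X (s - 1) →
        ∃ j ∈ S.L s, j ≠ i₀ ∧ ∃ a, S.Edge j i₀ a s ∧ S.X (a - 1) = W := by
  have hT := S.T₁_lt_T₂
  have hT1 := S.one_le
  have hk := S.two_le
  have hp : S.perms (s - 1) s = {S.X (s - 1)} := by
    ext P
    rw [mem_perms, Finset.mem_singleton]
    constructor
    · rintro ⟨v, h1, h2, rfl⟩
      rw [show v = s - 1 by omega]
    · rintro rfl
      exact ⟨s - 1, le_rfl, by omega, rfl⟩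
  have huniv : Chain (S.perms (s - 1) s) Finset.univ := by
    rw [hp]
    intro i _ j _ P hP P' hP' h
    rw [Finset.mem_singleton] at hP hP'
    rwa [hP', ← hP]
  have hp1 : (S.perms (s - 1) s).card = 1 := by rw [hp, Finset.card_singleton]
  obtain ⟨i₀, h1, h2, h3, h4⟩ := drop_chain (by omega : s - 1 < s) (by omega) hs
    (L_nonempty (by omega) h) (fun j hj => drops_of_mem_L (by omega) hj)
    (huniv.mono subset_rfl (Finset.subset_univ _))
  have h5 : (S.perms (s - 1) (s + 1)).card = 2 := by
    rw [card_perms_succ (by omega), hp1]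
    rw [hp, Finset.mem_singleton]
    exact h.symm
  have h6 := card_chain_le (k - 2) (by omega : S.T₂ ≤ s - 1) (by omega : s - 1 < s + 1)
    (chain_sdiff_Los (by omega) (by omega) huniv) (by omega)
  have h7 := card_Los_sdiff (S := S) Finset.univ s
  have hn := S.card_eq
  rw [Nat.choose_succ_succ' k 1, Nat.choose_one_right] at hn
  rw [Finset.card_univ, Fintype.card_fin] at h7
  rw [show k - 2 + 2 = k by omega] at h6
  have h8 : (S.L s).card = k := by
    change (S.Los Finset.univ s).card = k
    change (S.Los Finset.univ s).card + _ ≤ _ at h3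
    have : (1 + 1 : ℕ) = 2 := rfl
    rw [this] at hn
    omega
  refine ⟨h8, i₀, h1, fun j hj hne => ?_, fun W hW hWn => ?_⟩
  · obtain ⟨h9, a, -, ha⟩ := h2 j hj hne
    refine ⟨h9, a, ha, fun he => ha.ed.notMem ?_⟩
    rw [he]
    have := ha.consec.lt
    exact X_mem_perms (by omega) (by omega)
  · obtain ⟨j, hj, hne, a, -, ha, hX⟩ := h4 (by omega) W hW
      (by rwa [hp, Finset.mem_singleton])
    exact ⟨j, hj, hne, a, ha, hX⟩

lemma card_L {s : ℕ} (hs : S.T₂ < s) (h : S.X (s - 1) ≠ S.X s) : (S.L s).card = k :=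
  (trans_aux hs h).1

/-- `i` is the largest function in the order `P`. -/
def IsMax (P : Fin n → Fin n → Prop) (i : Fin n) : Prop := ∀ j, j ≠ i → P j i

lemma exists_isMax (hn : 0 < n) {N : ℕ} (hN : S.T₁ ≤ N) : ∃ i, IsMax (S.X N) i := by
  obtain ⟨i, -, hi⟩ := S.exists_max Finset.univ ⟨⟨0, hn⟩, Finset.mem_univ _⟩ hN
  exact ⟨i, fun j hj => hi j (Finset.mem_univ _) hj⟩

lemma IsMax.unique {N : ℕ} {i j : Fin n} (hi : IsMax (S.X N) i) (hj : IsMax (S.X N) j) :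
    i = j := by
  by_contra hne
  exact lt_asymm (hi j (Ne.symm hne)) (hj i hne)

/-- At a moment of change, the largest function loses its place, and every order other than the
preceding one is the order in which some other loser dropped for the last time. -/
lemma trans_structure {s : ℕ} (hs : S.T₂ < s) (h : S.X (s - 1) ≠ S.X s) :
    ∃ i₀ ∈ S.L s, IsMax (S.X (s - 1)) i₀ ∧
      (∀ j ∈ S.L s, j ≠ i₀ → ∃ a, S.Edge j i₀ a s ∧ S.X (a - 1) ≠ S.X (s - 1)) ∧
      ∀ W ∈ S.R, W ≠ S.X (s - 1) →
        ∃ j ∈ S.L s, j ≠ i₀ ∧ ∃ a, S.Edge j i₀ a s ∧ S.X (a - 1) = W := by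
  have hT := S.T₁_lt_T₂
  obtain ⟨hc, i₀, h1, h2, h3⟩ := trans_aux hs h
  refine ⟨i₀, h1, ?_, fun j hj hne => (h2 j hj hne).2, h3⟩
  obtain ⟨M, hM⟩ := exists_isMax (S := S) (N := s - 1) (Fin.pos i₀) (by omega)
  by_cases hML : M ∈ S.L s
  · by_cases hMi : M = i₀
    · rwa [← hMi]
    · exact absurd (h2 M hML hMi).1 (lt_asymm (hM i₀ (Ne.symm hMi)))
  exfalso
  have hne : M ≠ i₀ := fun h => hML (h ▸ h1)
  obtain ⟨P, hP, hPM⟩ := exists_rel (S := S) hne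
  obtain ⟨N, hN, rfl⟩ := S.occurs_inf P hP s
  obtain ⟨v, h4, h5, h6, h7⟩ := exists_first_switch (p := fun v => IsMax (S.X v) M)
    (u := s - 1) (w := N) hM (fun h => lt_asymm (h i₀ (Ne.symm hne)) hPM) (by omega)
  have hMv : M ∈ S.L v := by
    simp only [IsMax, not_forall] at h6
    obtain ⟨j, hj, hj'⟩ := h6
    refine mem_L.2 ⟨j, h7 (v - 1) (by omega) (by omega) j hj, ?_⟩
    exact (lt_or_gt (S := S) (by omega) hj).resolve_left hj'
  have hvs : v ≠ s := by rintro rfl; exact hML hMv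
  obtain ⟨-, i₁, h8, h9, h10⟩ := trans_aux (by omega : S.T₂ < v) (X_pred_ne_of_mem_L hMv)
  have hi₁ : M = i₁ := by
    by_contra hMi
    exact lt_asymm (h9 M hMv hMi).1 (h7 (v - 1) (by omega) (by omega) i₁ (Ne.symm hMi))
  subst hi₁
  obtain ⟨u, hu1, hu2, hu3⟩ : ∃ u, s - 1 ≤ u ∧ u < v ∧ S.X u ≠ S.X (v - 1) := by
    by_cases hs1 : S.X s = S.X (v - 1)
    · exact ⟨s - 1, le_rfl, by omega, hs1 ▸ h⟩
    · exact ⟨s, by omega, by omega, hs1⟩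
  obtain ⟨j, -, hj, a, ha, haX⟩ := h10 _ (X_mem (by omega : S.T₁ ≤ u)) hu3
  have h11 : S.X (a - 1) M j := ha.before
  rw [haX] at h11
  exact lt_asymm h11 (h7 u hu1 hu2 j hj)

lemma exists_ne_mem_R (P : Fin n → Fin n → Prop) : ∃ P' ∈ S.R, P' ≠ P := by
  have h1 := S.card_R
  have h2 := S.two_le
  exact Finset.exists_mem_ne (by omega) P

lemma exists_leaving {P : Fin n → Fin n → Prop} (hP : P ∈ S.R) (T : ℕ) :
    ∃ v, T < v ∧ S.X (v - 1) = P ∧ S.X v ≠ P := by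
  obtain ⟨P', hP', hne⟩ := S.exists_ne_mem_R P
  obtain ⟨u, h1, h2⟩ := S.occurs_inf P hP T
  obtain ⟨w, h3, h4⟩ := S.occurs_inf P' hP' u
  obtain ⟨v, h5, h6, h7, h8⟩ := exists_first_switch (p := fun v => S.X v = P) (u := u) (w := w) h2
    (fun h => hne (h4.symm.trans h)) h3
  exact ⟨v, by omega, h8 (v - 1) (by omega) (by omega), h7⟩

/-- Distinct orders have distinct maxima. -/
lemma IsMax.eq {P P' : Fin n → Fin n → Prop} {i : Fin n} (hP : P ∈ S.R) (hP' : P' ∈ S.R)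
    (h : IsMax P i) (h' : IsMax P' i) : P = P' := by
  by_contra hne
  obtain ⟨v, h1, rfl, h3⟩ := exists_leaving hP S.T₂
  obtain ⟨i₀, h4, h5, -, h7⟩ := trans_structure h1 (Ne.symm h3)
  have := h.unique h5
  subst this
  obtain ⟨j, -, hj, a, ha, rfl⟩ := h7 P' hP' (Ne.symm hne)
  exact lt_asymm ha.before (h' j hj)

/-- A full period of the behaviour of `ν` and `y` around the order `Z`. -/
structure Window (S : StairSys n k) (Z : Fin n → Fin n → Prop) (ν y : Fin n) (b a r b' : ℕ) :
    Prop where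
  lt : S.T₂ < b
  consec_left : Consec (S.f ν) b r
  consec_right : Consec (S.f ν) r b'
  consec_left' : Consec (S.f y) b a
  consec_right' : Consec (S.f y) a b'
  lt' : a < r
  X_left : S.X (b - 1) = Z
  X_right : S.X (b' - 1) = Z
  X_right_ne : S.X b' ≠ Z
  X_eq : ∀ v, r ≤ v → v < b' → S.X v = Z
  X_ne : ∀ v, b ≤ v → v < r → S.X v ≠ Z
  trans : S.X (a - 1) ≠ S.X a

section Low

variable {Z : Fin n → Fin n → Prop} {σ ν y : Fin n}

lemma exists_window (hZ : Z ∈ S.R) (hW : ∀ W ∈ S.R, W ≠ Z → W y ν ∧ W ν σ)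
    (hZσ : Z σ ν) (hZν : Z ν y) (hmax : ¬ IsMax Z y) {b : ℕ} (hb : S.T₂ < b)
    (hb1 : S.X (b - 1) = Z) (hb2 : S.X b ≠ Z) : ∃ a r b', S.Window Z ν y b a r b' := by
  have hT := S.T₁_lt_T₂
  have hT1 := S.one_le
  obtain ⟨N, hN, hNZ⟩ := S.occurs_inf Z hZ b
  obtain ⟨r, h1, -, h2, h3⟩ := exists_first_switch (p := fun v => S.X v ≠ Z) hb2
    (not_not.2 hNZ) hN
  rw [not_not] at h2
  obtain ⟨W, hWR, hWZ⟩ := S.exists_ne_mem_R Z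
  obtain ⟨N', hN', hNW⟩ := S.occurs_inf W hWR r
  obtain ⟨b', h4, -, h5, h6⟩ := exists_first_switch (p := fun v => S.X v = Z) h2
    (fun h => hWZ (hNW.symm.trans h)) hN'
  have hout : ∀ v, S.T₁ ≤ v → S.X v ≠ Z → S.f y v < S.f ν v ∧ S.f ν v < S.f σ v :=
    fun v hv hvZ => hW _ (X_mem hv) hvZ
  have hin : ∀ v, S.X v = Z → S.f σ v < S.f ν v ∧ S.f ν v < S.f y v := by
    rintro v rfl
    exact ⟨hZσ, hZν⟩
  have leave : ∀ c, S.T₂ < c → S.X (c - 1) = Z → S.X c ≠ Z → ν ∈ S.L c ∧ y ∈ S.L c := by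
    intro c hc h7 h8
    obtain ⟨h9, h10⟩ := hin _ h7
    obtain ⟨h11, h12⟩ := hout _ (by omega) h8
    exact ⟨mem_L.2 ⟨σ, h9, h12⟩, mem_L.2 ⟨ν, h10, h11⟩⟩
  obtain ⟨hνb, hyb⟩ := leave b hb hb1 hb2
  obtain ⟨hνb', hyb'⟩ := leave b' (by omega) (h6 _ (by omega) (by omega)) h5
  have hr1 := hout (r - 1) (by omega) (h3 _ (by omega) (by omega))
  have hr2 := hin r h2
  have hνr : Drops (S.f ν) r := drops_of_mem_L (by omega) (mem_L.2 ⟨y, hr1.1, hr2.2⟩)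
  have hσr : Drops (S.f σ) r := drops_of_mem_L (by omega) (mem_L.2 ⟨ν, hr1.2, hr2.1⟩)
  have dνb := drops_of_mem_L (by omega) hνb
  have dyb := drops_of_mem_L (by omega) hyb
  have dνb' := drops_of_mem_L (by omega) hνb'
  have dyb' := drops_of_mem_L (by omega) hyb'
  have hc1 : Consec (S.f ν) b r := by
    obtain ⟨x, hx⟩ := (S.stair ν).exists_succ dνb
    have h7 := hx.le_of_drops hνr (by omega)
    rcases eq_or_lt_of_le h7 with rfl | h8
    · exact hx
    · exact absurd hx.drops ((S.stair σ).not_drops_of_gt (S.stair ν) (u := b) (by omega)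
        (fun v hv hv' => (hout v (by omega) (h3 v hv hv')).2) hσr hνr hx.lt h8)
  have hc2 : Consec (S.f ν) r b' := by
    obtain ⟨x, hx⟩ := (S.stair ν).exists_succ hνr
    have h7 := hx.le_of_drops dνb' (by omega)
    rcases eq_or_lt_of_le h7 with rfl | h8
    · exact hx
    · exact absurd hx.drops ((S.stair y).not_drops_of_gt (S.stair ν) (u := r) (by omega)
        (fun v hv hv' => (hin v (h6 v hv hv')).2) dyb' dνb' hx.lt h8)
  have hXb' := h6 (b' - 1) (by omega) (by omega)
  obtain ⟨i₀, -, h7, h8, -⟩ := trans_structure (by omega : S.T₂ < b') (X_pred_ne_of_mem_L hyb')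
  obtain ⟨a, ha, haX⟩ := h8 y hyb' (by rintro rfl; exact hmax (hXb' ▸ h7))
  rw [hXb'] at haX
  have har : a ≤ r := by
    by_contra hcon
    have := ha.consec.lt
    exact haX (h6 (a - 1) (by omega) (by omega))
  have har' : a ≠ r := by
    rintro rfl
    refine S.unlinked y ν ?_ a b' (by omega) ha.consec hc2
    rintro rfl
    exact lt_irrefl _ hr1.1
  have hba : b < a := by
    have h9 := ha.consec.le_left_of_drops dyb (by omega)
    refine lt_of_le_of_ne h9 ?_
    rintro rfl
    exact haX hb1
  have hyba : Consec (S.f y) b a := by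
    obtain ⟨x, hx⟩ := (S.stair y).exists_succ dyb
    have hda := ha.consec.drops_left (by omega)
    have h9 := hx.le_of_drops hda hba
    rcases eq_or_lt_of_le h9 with rfl | h10
    · exact hx
    · obtain ⟨x', hx'⟩ := (S.stair y).exists_succ hx.drops
      have h11 := hx'.le_of_drops hda h10
      have h12 := (S.stair ν).not_two_drops (S.stair y) (hout b (by omega) hb2).1 hc1 le_rfl h1
        hx le_rfl hx.lt hx'
      omega
  exact ⟨a, r, b', hb, hc1, hc2, hyba, ha.consec, by omega, hb1, hXb', h5, h6, h3,
    X_pred_ne_of_mem_L ha.mem_L⟩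

lemma Window.shift (hW : ∀ W ∈ S.R, W ≠ Z → W y ν) (hZν : Z ν y) {b a r b' a' r' b'' : ℕ}
    (h : S.Window Z ν y b a r b') (h' : S.Window Z ν y b' a' r' b'') : r' + a = a' + r := by
  have hT := S.T₁_lt_T₂
  obtain ⟨C, -, hC⟩ := (S.stair ν).recur _ _ _ h.consec_right h'.consec_left
  obtain ⟨C', -, hC'⟩ := (S.stair y).recur _ _ _ h.consec_right' h'.consec_left'
  have e1 := (S.stair ν).three_term h.consec_right h'.consec_left hC
  have e2 := (S.stair y).three_term h.consec_right' h'.consec_left' hC'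
  have h1 := h.lt'
  have h2 := h'.lt'
  have h3 := h.consec_right.lt
  have h3' := h.consec_left.lt
  have h4 := h.lt
  have i1 : S.f ν r < S.f y a := by
    have h5 : S.X r ν y := by rw [h.X_eq r le_rfl h3]; exact hZν
    rwa [← h.consec_right'.const h1.le h3]
  have i2 : S.f y b' < S.f ν b' := hW _ (X_mem (by omega)) h.X_right_ne
  have i3 := h'.consec_left'.value_lt
  have i4 := (S.stair ν).pos r' (by omega)
  have i5 := (S.stair y).pos b' (by omega)
  have hle : C' ≤ C := by
    by_contra hcon
    have h6 := Nat.mul_le_mul_right b' (by omega : C + 1 ≤ C')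
    have h7 : (C + 1) * b' = C * b' + b' := Nat.succ_mul C b'
    omega
  have hge : C ≤ C' := by
    by_contra hcon
    have h6 : (C' : ℝ) + 1 ≤ C := by exact_mod_cast (by omega : C' + 1 ≤ C)
    have h7 : ((C' : ℝ) + 1) * S.f ν b' ≤ C * S.f ν b' :=
      mul_le_mul_of_nonneg_right h6 (by linarith)
    have h8 : ((C' : ℝ) + 1) * S.f y b' ≤ (C' + 1) * S.f ν b' :=
      mul_le_mul_of_nonneg_left i2.le (by positivity)
    linarith
  have : C = C' := by omega
  subst this
  omega

/-- If `y`, `ν`, `σ` are ordered in this way in all orders but `Z`, and reversed in `Z`, then `y` is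
the maximum of `Z`. -/
lemma isMax_of_reversed (hZ : Z ∈ S.R) (hW : ∀ W ∈ S.R, W ≠ Z → W y ν ∧ W ν σ)
    (hZσ : Z σ ν) (hZν : Z ν y) : IsMax Z y := by
  by_contra hmax
  have hT := S.T₁_lt_T₂
  have hT1 := S.one_le
  obtain ⟨b₀, h1, h2, h3⟩ := exists_leaving hZ S.T₂
  obtain ⟨a₀, r₀, b₁, hw₀⟩ := exists_window hZ hW hZσ hZν hmax h1 h2 h3
  have hall : ∀ m : ℕ, ∃ b a r b', S.Window Z ν y b a r b' ∧ m ≤ b ∧ r + a₀ = a + r₀ := by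
    intro m
    induction m with
    | zero => exact ⟨b₀, a₀, r₀, b₁, hw₀, by omega, by omega⟩
    | succ m ih =>
      obtain ⟨b, a, r, b', hw, h4, h5⟩ := ih
      have h6 := hw.consec_left.lt
      have h7 := hw.consec_right.lt
      have h8 := hw.lt
      obtain ⟨a', r', b'', hw'⟩ := exists_window hZ hW hZσ hZν hmax (by omega : S.T₂ < b')
        hw.X_right hw.X_right_ne
      have h9 := hw.shift (fun W h h' => (hW W h h').1) hZν hw'
      exact ⟨b', a', r', b'', hw', by omega, by omega⟩
  choose d hd hd' using fun e => (S.stair e).exists_drops_gt r₀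
  obtain ⟨b, a, r, b', hw, h4, h5⟩ := hall (Finset.univ.sup d)
  have hb := hw.lt
  have hba := hw.consec_left'.lt
  have har := hw.lt'
  have hrb := hw.consec_right.lt
  obtain ⟨s, h6, h7, h8, h9⟩ := exists_last_switch (x := S.X) (w := r - 1) hw.trans (by omega)
  have hXr : S.X (r - 1) ≠ S.X r := by
    rw [hw.X_eq r le_rfl hrb]
    exact hw.X_ne _ (by omega) (by omega)
  rw [h9 s le_rfl h7] at h8
  obtain ⟨i₀, -, -, -, h10⟩ := trans_structure (by omega : S.T₂ < r) hXr
  obtain ⟨e, -, -, c, he, hc⟩ := h10 _ (X_mem (by omega : S.T₁ ≤ s - 1)) h8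
  have hcr := he.consec.lt
  have hcs : c = s := by
    rcases lt_trichotomy c s with h11 | h11 | h11
    · exact absurd (hc ▸ X_mem_perms (by omega) (by omega)) he.ed.notMem
    · exact h11
    · exact absurd (hc.symm.trans (h9 _ (by omega) (by omega))) h8
  subst hcs
  obtain ⟨q, hq⟩ := (S.stair e).exists_pred (he.consec.drops_left (by omega))
  have h11 := (S.stair e).add_le_of_consec hq he.consec
  have h12 := hq.le_of_drops (hd' e) (by have := hd e; omega)
  have h13 : d e ≤ Finset.univ.sup d := Finset.le_sup (Finset.mem_univ e)
  omega

end Low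

lemma exists_last_new {t : ℕ} (d : ℕ) : ∀ {s : ℕ}, t ≤ s →
    (S.perms t s).card + (d + 1) = k →
    ∃ r, s ≤ r ∧ (S.perms t r).card + 1 = k ∧ S.X r ∉ S.perms t r := by
  induction d with
  | zero =>
    intro s hts hd
    obtain ⟨r, h1, h2, h3⟩ := exists_new (S := S) (t := t) (s := s) (by omega)
    exact ⟨r, h1, by rw [h2]; omega, by rwa [h2]⟩
  | succ d ih =>
    intro s hts hd
    obtain ⟨r, h1, h2, h3⟩ := exists_new (S := S) (t := t) (s := s) (by omega)
    rw [← h2] at h3 hd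
    obtain ⟨r', h4, h5, h6⟩ := ih (s := r + 1) (by omega)
      (by rw [card_perms_succ (by omega) h3]; omega)
    exact ⟨r', by omega, h5, h6⟩

/-- Between two occurrences of an order, separated by a change, all orders occur. -/
theorem perms_eq_R_of_return {t s : ℕ} (ht : S.T₂ < t) (hts : t < s) (hX : S.X t = S.X s)
    (hs : S.X (s - 1) ≠ S.X s) : S.perms t s = S.R := by
  classical
  have hT := S.T₁_lt_T₂
  have hT1 := S.one_le
  by_contra hne
  have hcard : (S.perms t s).card < k := by
    by_contra hcon
    exact hne (perms_eq_R (by omega) (by omega))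
  obtain ⟨r, hsr, hr, hrn⟩ := exists_last_new (S := S) (t := t)
    (k - (S.perms t s).card - 1) (s := s) hts.le (by omega)
  have hsr' : s < r := by
    refine lt_of_le_of_ne hsr ?_
    rintro rfl
    exact hrn (hX ▸ X_mem_perms le_rfl hts)
  have hfull : S.perms t (r + 1) = S.R :=
    perms_eq_R (by omega) (by rw [card_perms_succ (by omega) hrn]; omega)
  have hR : ∀ W ∈ S.R, W ≠ S.X r → W ∈ S.perms t r := by
    intro W hW hWr
    rw [← hfull, perms_succ (by omega), Finset.mem_insert] at hW
    exact hW.resolve_left hWr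
  have hR' : ∀ W ∈ S.R, W ∉ S.perms t r → W = S.X r := fun W h1 h2 =>
    by_contra fun h3 => h2 (hR W h1 h3)
  obtain ⟨Q, hQ, hQc, hEd⟩ := exists_large_chain (S := S) (t := t) (s := r) (by omega) (by omega)
  rw [show k - (S.perms t r).card + 2 = 3 by omega, show Nat.choose 3 2 = 3 by decide] at hQc
  obtain ⟨σ, hσ, hσm⟩ := S.exists_max Q (Finset.card_pos.1 (by omega)) (N := t) (by omega)
  have hc1 := Finset.card_erase_of_mem hσ
  obtain ⟨ν, hν, hνm⟩ := S.exists_max (Q.erase σ) (Finset.card_pos.1 (by omega)) (N := t) (by omega)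
  have hc2 := Finset.card_erase_of_mem hν
  obtain ⟨w, hw⟩ := Finset.card_pos.1 (by omega : 0 < ((Q.erase σ).erase ν).card)
  obtain ⟨hwν, hw⟩ := Finset.mem_erase.1 hw
  have hwt := hνm w hw hwν
  obtain ⟨hwσ, hw⟩ := Finset.mem_erase.1 hw
  obtain ⟨hνσ, hν⟩ := Finset.mem_erase.1 hν
  have hνt := hσm ν hν hνσ
  have hXt : S.X t ∈ S.perms t r := X_mem_perms le_rfl (by omega)
  -- pairs ordered equally in all orders of `[t, r)` are reversed at `r`
  have rev : ∀ {x z : Fin n}, (∀ v, t ≤ v → v < r → S.f x v < S.f z v) → S.X r z x := by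
    intro x z h
    have hxz : x ≠ z := by rintro rfl; exact lt_irrefl _ (h t le_rfl (by omega))
    obtain ⟨P, hP, hPzx⟩ := exists_rel (S := S) (Ne.symm hxz)
    rw [hR' P hP] at hPzx
    · exact hPzx
    · intro hm
      obtain ⟨v, h1, h2, rfl⟩ := mem_perms.1 hm
      exact lt_asymm hPzx (h v h1 h2)
  have hνσ' : ∀ v, t ≤ v → v < r → S.f ν v < S.f σ v := fun v h1 h2 =>
    hQ ν hν σ hσ _ hXt _ (X_mem_perms h1 h2) hνt
  have hwν' : ∀ v, t ≤ v → v < r → S.f w v < S.f ν v := fun v h1 h2 =>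
    hQ w hw ν hν _ hXt _ (X_mem_perms h1 h2) hwt
  have hZσ := rev hνσ'
  have hZν := rev hwν'
  have hσr : Drops (S.f σ) r := drops_of_mem_L (by omega)
    (mem_L.2 ⟨ν, hνσ' _ (by omega) (by omega), hZσ⟩)
  have hνr : Drops (S.f ν) r := drops_of_mem_L (by omega)
    (mem_L.2 ⟨w, hwν' _ (by omega) (by omega), hZν⟩)
  obtain ⟨a, ha⟩ := exists_edge (by omega : S.T₂ < r) hσr hνr (hνσ' _ (by omega) (by omega))
  have har := ha.consec.lt
  have hat : a ≤ t := by
    by_contra hcon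
    exact lt_asymm ha.before (hνσ' _ (by omega) (by omega))
  have hconst : ∀ v, t ≤ v → v < r → S.f ν v = S.f ν t := fun v h1 h2 => by
    rw [ha.consec.const (c := v) (by omega) h2, ha.consec.const (c := t) hat (by omega)]
  have hall : ∀ x z : Fin n, (∀ v, t ≤ v → v < r → S.f x v < S.f z v) →
      ∀ W ∈ S.R, W ≠ S.X r → W x z := by
    intro x z h W hW hWr
    obtain ⟨v, h1, h2, rfl⟩ := mem_perms.1 (hR W hW hWr)
    exact h v h1 h2
  have low : ∀ y, S.f y t < S.f ν t → IsMax (S.X r) y := by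
    intro y hy
    have h1 : ∀ v, t ≤ v → v < r → S.f y v < S.f ν v := fun v h1 h2 => by
      rw [hconst v h1 h2]
      exact ((S.stair y).anti t v (by omega) h1).trans_lt hy
    exact isMax_of_reversed (X_mem (by omega))
      (fun W hW hWr => ⟨hall _ _ h1 W hW hWr, hall _ _ hνσ' W hW hWr⟩) hZσ (rev h1)
  have low' : ∀ y, S.f y t < S.f ν t → y = w := fun y hy => (low y hy).unique (low w hwt)
  have hmin : ∀ v, t ≤ v → v ≤ s → ∀ y, y ≠ w → S.f w v < S.f y v := by
    intro v h1 h2 y hy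
    by_cases hyν : y = ν
    · rw [hyν]; exact hwν' v h1 (by omega)
    · refine (hwν' v h1 (by omega)).trans ?_
      refine (lt_or_gt (S := S) (by omega : S.T₁ ≤ v) (Ne.symm hyν)).resolve_right fun h3 => hy ?_
      have h4 : S.X s y ν := by
        have h5 := (S.stair y).anti v s (by omega) h2
        change S.f y s < S.f ν s
        rw [hconst s (by omega) (by omega), ← hconst v h1 (by omega)]
        exact h5.trans_lt h3
      rw [← hX] at h4
      exact low' y h4
  -- the losers at `s` that are constant on `[t, s)`
  set D := (S.L s).filter fun j => ∃ x ≤ t, Consec (S.f j) x s with hD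
  obtain ⟨θ, hθ, -, -, hθe⟩ := trans_structure (by omega : S.T₂ < s) hs
  have hedge : ∀ W ∈ S.R \ S.perms t s, ∃ j ∈ S.L s, j ≠ θ ∧ ∃ x ≤ t, S.Edge j θ x s ∧
      S.X (x - 1) = W := by
    intro W hW
    obtain ⟨h1, h2⟩ := Finset.mem_sdiff.1 hW
    obtain ⟨j, hj, hjθ, x, hx, hxW⟩ := hθe W h1 (by
      rintro rfl; exact h2 (X_mem_perms (by omega) (by omega)))
    refine ⟨j, hj, hjθ, x, ?_, hx, hxW⟩
    by_contra hcon
    have := hx.consec.lt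
    exact h2 (hxW ▸ X_mem_perms (by omega) (by omega))
  have hθD : θ ∈ D := by
    obtain ⟨W, hW⟩ := Finset.card_pos.1 (by
      rw [Finset.card_sdiff_of_subset (perms_subset (by omega)), S.card_R]; omega :
      0 < (S.R \ S.perms t s).card)
    obtain ⟨j, hj, hjθ, x, hxt, hx, -⟩ := hedge W hW
    obtain ⟨z, hz⟩ := (S.stair θ).exists_pred (drops_of_mem_L (by omega) hθ)
    refine Finset.mem_filter.2 ⟨hθ, z, ?_, hz⟩
    have h1 := hx.after (s - 1) (by omega) (by omega)
    have hzs := hz.lt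
    rw [hz.const (c := s - 1) (by omega) (by omega),
      hx.consec.const (c := s - 1) (by omega) (by omega)] at h1
    have h2 : S.X s j θ := hX ▸ hx.after t hxt hts
    have := (S.stair θ).left_lt_of_gt (S.stair j) hz hx.consec h1 h2
    omega
  have : Nonempty (Fin n) := ⟨θ⟩
  choose! e he using hedge
  have hDcard : k + 1 ≤ D.card + (S.perms t s).card := by
    have h1 : (S.R \ S.perms t s).card ≤ (D.erase θ).card := by
      refine Finset.card_le_card_of_injOn e ?_ ?_
      · intro W hW
        obtain ⟨h1, h2, x, h3, h4, -⟩ := he W hW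
        exact Finset.mem_erase.2 ⟨h2, Finset.mem_filter.2 ⟨h1, x, h3, h4.consec⟩⟩
      · intro W hW W' hW' heq
        obtain ⟨-, -, x, -, h4, h5⟩ := he W hW
        obtain ⟨-, -, x', -, h4', h5'⟩ := he W' hW'
        have h6 := h4.consec
        rw [heq] at h6
        rw [← h5, ← h5', h6.left_unique h4'.consec]
    rw [Finset.card_erase_of_mem hθD, Finset.card_sdiff_of_subset (perms_subset (by omega)),
      S.card_R] at h1
    have := Finset.card_pos.2 ⟨θ, hθD⟩
    omega
  have hwD : w ∉ D := by
    intro h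
    obtain ⟨j, h1, -⟩ := mem_L.1 (Finset.mem_filter.1 h).1
    have hjw : j ≠ w := by rintro rfl; exact lt_irrefl _ h1
    exact lt_asymm h1 (hmin (s - 1) (by omega) (by omega) j hjw)
  have hchain : Chain (S.perms t s) (insert w D) := by
    intro i hi j hj P hP P' hP' h
    obtain ⟨v, h1, h2, rfl⟩ := mem_perms.1 hP
    obtain ⟨v', h1', h2', rfl⟩ := mem_perms.1 hP'
    by_cases hjw : j = w
    · exfalso
      subst hjw
      by_cases hij : i = j
      · subst hij; exact lt_irrefl _ h
      · exact lt_asymm h (hmin v h1 h2.le i hij)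
    by_cases hiw : i = w
    · subst hiw
      exact hmin v' h1' h2'.le j hjw
    obtain ⟨-, x, hx, hx'⟩ := Finset.mem_filter.1 ((Finset.mem_insert.1 hi).resolve_left hiw)
    obtain ⟨-, z, hz, hz'⟩ := Finset.mem_filter.1 ((Finset.mem_insert.1 hj).resolve_left hjw)
    change S.f i v < S.f j v at h
    change S.f i v' < S.f j v'
    rw [hx'.const (c := v) (by omega) h2, hz'.const (c := v) (by omega) h2] at h
    rwa [hx'.const (c := v') (by omega) h2', hz'.const (c := v') (by omega) h2']
  have hup := card_chain_le_of_not_ed (k - (S.perms t s).card) (by omega : S.T₂ ≤ t) hts hchain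
    (by omega) (by
      intro s₁ hs₁ hnew j hj a' ha' hed
      have hss : s ≠ s₁ := by
        rintro rfl
        exact hnew (hX ▸ X_mem_perms le_rfl hts)
      rcases Finset.mem_insert.1 hj with rfl | hjD
      · rcases lt_trichotomy s₁ r with h1 | h1 | h1
        · exact hEd s₁ (by omega) h1 hnew j hw a' ha' hed
        · subst h1
          have h2 := hR' _ hed.X_mem fun h => hed.notMem (perms_mono ha' le_rfl h)
          have h3 := hR' _ ha.ed.X_mem fun h => ha.ed.notMem (perms_mono hat le_rfl h)
          exact hwν (hed.unique ha.ed (h2.trans h3.symm)).1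
        · refine hnew (perms_mono le_rfl (by omega : r + 1 ≤ s₁) ?_)
          rw [hfull]
          exact X_mem (by omega)
      · obtain ⟨h1, x, -, hx⟩ := Finset.mem_filter.1 hjD
        have := hed.consec.le_of_drops hx.drops (by omega)
        omega)
  rw [Finset.card_insert_of_notMem hwD] at hup
  omega

end StairSys

namespace StairSys

variable {n k : ℕ} {S : StairSys n k}

/-- `τ` enumerates the moments of change from some point on. -/
structure Enum (S : StairSys n k) (τ : ℕ → ℕ) : Prop where
  mono : StrictMono τ
  lt : S.T₂ < τ 0
  trans : ∀ m, S.X (τ m - 1) ≠ S.X (τ m)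
  surj : ∀ s, τ 0 ≤ s → S.X (s - 1) ≠ S.X s → ∃ m, τ m = s

variable (S) in
lemma exists_enum : ∃ τ, S.Enum τ := by
  set p : ℕ → Prop := fun s => S.T₂ < s ∧ S.X (s - 1) ≠ S.X s with hp
  have hinf : {s | p s}.Infinite := by
    refine Set.infinite_of_not_bddAbove ?_
    rintro ⟨b, hb⟩
    obtain ⟨P, hP, -⟩ := S.exists_ne_mem_R (S.X 0)
    obtain ⟨v, h1, h2, h3⟩ := exists_leaving hP (max S.T₂ b)
    have h4 : v ∈ {s | p s} := ⟨by omega, by rw [h2]; exact h3.symm⟩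
    have := hb h4
    omega
  refine ⟨Nat.nth p, Nat.nth_strictMono hinf, (Nat.nth_mem_of_infinite hinf 0).1,
    fun m => (Nat.nth_mem_of_infinite hinf m).2, fun s h1 h2 => ?_⟩
  obtain ⟨m, -, hm⟩ := Nat.exists_lt_card_nth_eq
    (show p s from ⟨(Nat.nth_mem_of_infinite hinf 0).1.trans_le h1, h2⟩)
  exact ⟨m, hm⟩

namespace Enum

variable {τ : ℕ → ℕ}

lemma T₂_lt (h : S.Enum τ) (m : ℕ) : S.T₂ < τ m := h.lt.trans_le (h.mono.monotone (Nat.zero_le m))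

lemma T₁_lt (h : S.Enum τ) (m : ℕ) : S.T₁ < τ m := S.T₁_lt_T₂.trans (h.T₂_lt m)

lemma two_le (h : S.Enum τ) (m : ℕ) : 2 ≤ τ m := by
  have := h.T₁_lt m
  have := S.one_le
  omega

lemma mem_R (h : S.Enum τ) (m : ℕ) : S.X (τ m) ∈ S.R := X_mem (h.T₁_lt m).le

lemma X_eq (h : S.Enum τ) {m v : ℕ} (h1 : τ m ≤ v) (h2 : v < τ (m + 1)) : S.X v = S.X (τ m) := by
  obtain ⟨s, h3, h4, h5, h6⟩ := exists_last_switch (h.trans m) h1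
  obtain ⟨m', rfl⟩ := h.surj s ((h.mono.monotone (Nat.zero_le m)).trans h3) h5
  have h7 := h.mono.le_iff_le.1 h3
  have h8 := h.mono.lt_iff_lt.1 (h4.trans_lt h2)
  rw [← h6 _ le_rfl h4, show m' = m by omega]

lemma X_pred (h : S.Enum τ) (m : ℕ) : S.X (τ (m + 1) - 1) = S.X (τ m) := by
  have := h.mono (Nat.lt_add_one m)
  exact h.X_eq (by omega) (by omega)

lemma exists_index (h : S.Enum τ) {v : ℕ} (hv : τ 0 ≤ v) : ∃ m, τ m ≤ v ∧ v < τ (m + 1) := by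
  obtain ⟨m, h1, -, h2, h3⟩ := exists_first_switch (p := fun m => τ m ≤ v) (u := 0) (w := v + 1) hv
    (by have := h.mono.id_le (v + 1); simp only [id] at this; omega) (by omega)
  refine ⟨m - 1, h3 _ (by omega) (by omega), ?_⟩
  rw [show m - 1 + 1 = m by omega]
  omega

lemma perms_subset_image (h : S.Enum τ) [DecidableEq (Fin n → Fin n → Prop)] (p q : ℕ) :
    S.perms (τ p) (τ q) ⊆ (Finset.Ico p q).image fun m => S.X (τ m) := by
  intro P hP
  obtain ⟨v, h1, h2, rfl⟩ := mem_perms.1 hP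
  obtain ⟨m, h3, h4⟩ := h.exists_index ((h.mono.monotone (Nat.zero_le p)).trans h1)
  have h5 := h.mono.lt_iff_lt.1 (h1.trans_lt h4)
  have h6 := h.mono.lt_iff_lt.1 (h3.trans_lt h2)
  exact Finset.mem_image.2 ⟨m, Finset.mem_Ico.2 ⟨by omega, h6⟩, (h.X_eq h3 h4).symm⟩

lemma X_ne (h : S.Enum τ) {p q : ℕ} (h1 : p < q) (h2 : q < p + k) : S.X (τ p) ≠ S.X (τ q) := by
  classical
  intro he
  have h3 := perms_eq_R_of_return (h.T₂_lt p) (h.mono h1) he (h.trans q)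
  have h4 := Finset.card_le_card (h.perms_subset_image p q)
  have h5 := h4.trans Finset.card_image_le
  rw [h3, S.card_R, Nat.card_Ico] at h5
  omega

lemma image_eq_R (h : S.Enum τ) [DecidableEq (Fin n → Fin n → Prop)] (p : ℕ) :
    (Finset.Ico p (p + k)).image (fun m => S.X (τ m)) = S.R := by
  refine Finset.eq_of_subset_of_card_le ?_ ?_
  · intro P hP
    obtain ⟨m, -, rfl⟩ := Finset.mem_image.1 hP
    exact h.mem_R m
  · rw [Finset.card_image_of_injOn, S.card_R, Nat.card_Ico]
    · omega
    · intro a ha b hb hab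
      simp only [Finset.coe_Ico, Set.mem_Ico] at ha hb
      rcases lt_trichotomy a b with h1 | h1 | h1
      · exact absurd hab (h.X_ne h1 (by omega))
      · exact h1
      · exact absurd hab.symm (h.X_ne h1 (by omega))

lemma exists_X_eq (h : S.Enum τ) (p : ℕ) {P : Fin n → Fin n → Prop} (hP : P ∈ S.R) :
    ∃ m, p ≤ m ∧ m < p + k ∧ S.X (τ m) = P := by
  classical
  rw [← h.image_eq_R p] at hP
  obtain ⟨m, h1, h2⟩ := Finset.mem_image.1 hP
  exact ⟨m, (Finset.mem_Ico.1 h1).1, (Finset.mem_Ico.1 h1).2, h2⟩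

lemma X_add (h : S.Enum τ) (p : ℕ) : S.X (τ (p + k)) = S.X (τ p) := by
  obtain ⟨m, h1, h2, h3⟩ := h.exists_X_eq p (h.mem_R (p + k))
  rcases eq_or_lt_of_le h1 with rfl | h4
  · exact h3.symm
  · exact absurd h3 (h.X_ne h2 (by omega))

lemma X_eq_iff (h : S.Enum τ) (p q : ℕ) : S.X (τ p) = S.X (τ q) ↔ p % k = q % k := by
  have h1 : Function.Periodic (fun m => S.X (τ m)) k := h.X_add
  have h2 := h1.map_mod_nat p
  have h3 := h1.map_mod_nat q
  have hk : 0 < k := by have := S.two_le; omega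
  have h4 := Nat.mod_lt p hk
  have h5 := Nat.mod_lt q hk
  constructor
  · intro he
    rw [← h2, ← h3] at he
    rcases lt_trichotomy (p % k) (q % k) with h6 | h6 | h6
    · exact absurd he (h.X_ne h6 (by omega))
    · exact h6
    · exact absurd he.symm (h.X_ne h6 (by omega))
  · intro he
    rw [← h2, ← h3, he]

lemma mod_ne (h : S.Enum τ) {p q : ℕ} (h1 : p < q) (h2 : q < p + k) : p % k ≠ q % k := fun he =>
  h.X_ne h1 h2 ((h.X_eq_iff _ _).2 he)

lemma mem_L_iff (h : S.Enum τ) {m : ℕ} {i : Fin n} :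
    i ∈ S.L (τ (m + 1)) ↔ ∃ j, S.X (τ m) j i ∧ S.X (τ (m + 1)) i j := by
  rw [mem_L, ← h.X_pred m]
  rfl

lemma mem_L_congr (h : S.Enum τ) {p q : ℕ} (hp : 1 ≤ p) (hq : 1 ≤ q) (hpq : p % k = q % k) {i : Fin n} :
    i ∈ S.L (τ p) ↔ i ∈ S.L (τ q) := by
  obtain ⟨p, rfl⟩ := Nat.exists_eq_add_of_le' hp
  obtain ⟨q, rfl⟩ := Nat.exists_eq_add_of_le' hq
  have h1 : p % k = q % k := Nat.ModEq.add_right_cancel' 1 hpq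
  rw [h.mem_L_iff, h.mem_L_iff, (h.X_eq_iff _ _).2 h1, (h.X_eq_iff _ _).2 hpq]

/-- A non-maximal loser at `τ q` lost for the last time at one of the preceding `k - 1` moments. -/
lemma exists_edge_index (h : S.Enum τ) {q : ℕ} (hq : k ≤ q) {θ j : Fin n} {a : ℕ} (he : S.Edge j θ a (τ q))
    (hX : S.X (a - 1) ≠ S.X (τ q - 1)) : ∃ p, p < q ∧ q < p + k ∧ τ p = a := by
  have hk := S.two_le
  have hlt : τ (q - k) < a := by
    by_contra hcon
    refine he.ed.notMem ?_
    obtain ⟨m, h1, h2, h3⟩ := h.exists_X_eq (q - k) he.ed.X_mem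
    rw [← h3]
    have := h.mono.monotone h1
    exact X_mem_perms (by omega) (h.mono (by omega))
  obtain ⟨p, rfl⟩ := h.surj a ((h.mono.monotone (Nat.zero_le _)).trans hlt.le)
    (X_pred_ne_of_mem_L he.mem_L)
  have h1 := h.mono.lt_iff_lt.1 hlt
  exact ⟨p, h.mono.lt_iff_lt.1 he.consec.lt, by omega, rfl⟩

lemma exists_edge_of_gap (h : S.Enum τ) {p q : ℕ} (hq : k ≤ q) (hpq : p < q) (hqp : q < p + k) {θ : Fin n}
    (hθ : IsMax (S.X (τ (q - 1))) θ) :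
    ∃ j ∈ S.L (τ q), S.Edge j θ (τ p) (τ q) := by
  have hk := S.two_le
  have e1 := h.X_pred (q - 1)
  rw [show q - 1 + 1 = q by omega] at e1
  have e2 := h.X_pred (p - 1)
  rw [show p - 1 + 1 = p by omega] at e2
  obtain ⟨i₀, h1, h2, -, h3⟩ := trans_structure (h.T₂_lt q) (h.trans q)
  have h4 := h.X_ne (by omega : p - 1 < q - 1) (by omega)
  rw [e1] at h2
  obtain rfl := hθ.unique h2
  obtain ⟨j, hj, -, a, ha, haX⟩ := h3 _ (h.mem_R (p - 1)) (by rwa [e1])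
  obtain ⟨p', h5, h6, rfl⟩ := h.exists_edge_index hq ha (by rwa [haX, e1])
  have e3 := h.X_pred (p' - 1)
  rw [show p' - 1 + 1 = p' by omega, haX] at e3
  have h7 : p' = p := by
    rcases lt_trichotomy p' p with h7 | h7 | h7
    · exact absurd e3.symm (h.X_ne (by omega : p' - 1 < p - 1) (by omega))
    · exact h7
    · exact absurd e3 (h.X_ne (by omega : p - 1 < p' - 1) (by omega))
  exact ⟨j, hj, h7 ▸ ha⟩

lemma exists_pred_loss (h : S.Enum τ) {q : ℕ} (hq : k ≤ q) {j θ : Fin n} (hj : j ∈ S.L (τ q)) (hjθ : j ≠ θ)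
    (hθ : IsMax (S.X (τ (q - 1))) θ) : ∃ p, p < q ∧ q < p + k ∧ S.Edge j θ (τ p) (τ q) := by
  have hk := S.two_le
  have e1 := h.X_pred (q - 1)
  rw [show q - 1 + 1 = q by omega] at e1
  obtain ⟨i₀, h1, h2, h3, -⟩ := trans_structure (h.T₂_lt q) (h.trans q)
  rw [e1] at h2
  obtain rfl := hθ.unique h2
  obtain ⟨a, ha, haX⟩ := h3 j hj hjθ
  obtain ⟨p, h5, h6, rfl⟩ := h.exists_edge_index hq ha haX
  exact ⟨p, h5, h6, ha⟩

lemma exists_ne_of_two_le (hS : S.Enum τ) (f : Fin n) : ∃ g, g ≠ f := by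
  have h1 := S.two_le
  obtain ⟨P, hP, -⟩ := S.exists_ne_mem_R (S.X 0)
  have h2 := card_L (hS.T₂_lt 0) (hS.trans 0)
  obtain ⟨g, -, hg⟩ := Finset.exists_mem_ne (s := S.L (τ 0)) (by omega) f
  exact ⟨g, hg⟩

lemma exists_loss (h : S.Enum τ) (f : Fin n) (m : ℕ) : ∃ q, m ≤ q ∧ f ∈ S.L (τ q) := by
  obtain ⟨g, hg⟩ := exists_ne_of_two_le h f
  obtain ⟨P, hP, h1⟩ := exists_rel (S := S) hg
  obtain ⟨P', hP', h1'⟩ := exists_rel (S := S) (Ne.symm hg)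
  obtain ⟨p, h2, -, rfl⟩ := h.exists_X_eq m hP
  obtain ⟨p', h3, -, rfl⟩ := h.exists_X_eq p hP'
  obtain ⟨v, h4, -, h5, h6⟩ := exists_first_switch (p := fun v => S.X (τ v) g f) h1
    (fun h => lt_asymm h h1') h3
  refine ⟨v, by omega, ?_⟩
  have h7 := h6 (v - 1) (by omega) (by omega)
  rw [show v = v - 1 + 1 by omega] at h5 ⊢
  exact h.mem_L_iff.2 ⟨g, h7, (lt_or_gt (S := S) (h.T₁_lt _).le hg).resolve_left h5⟩

/-- The residues of the moments at which `f` loses. -/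
noncomputable def Λ (S : StairSys n k) (τ : ℕ → ℕ) (f : Fin n) : Finset ℕ :=
  (Finset.range k).filter fun c => f ∈ S.L (τ (k + c))

lemma mem_Λ (h : S.Enum τ) {q : ℕ} (hq : 1 ≤ q) {f : Fin n} : q % k ∈ Λ S τ f ↔ f ∈ S.L (τ q) := by
  have hk := S.two_le
  rw [Λ, Finset.mem_filter, Finset.mem_range]
  have h1 : (k + q % k) % k = q % k := by simp
  rw [h.mem_L_congr (by omega) hq h1]
  exact and_iff_right (Nat.mod_lt _ (by omega))

lemma exists_isMax (h : S.Enum τ) (m : ℕ) : ∃ θ, IsMax (S.X (τ m)) θ := by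
  obtain ⟨i, -⟩ := Finset.card_pos.1 (by
    rw [card_L (h.T₂_lt 0) (h.trans 0)]; have := S.two_le; omega : 0 < (S.L (τ 0)).card)
  exact StairSys.exists_isMax (Fin.pos i) (h.T₁_lt m).le

lemma one_le_card_Λ (h : S.Enum τ) (f : Fin n) : 1 ≤ (Λ S τ f).card := by
  obtain ⟨q, h1, h2⟩ := h.exists_loss f 1
  exact Finset.card_pos.2 ⟨_, (h.mem_Λ h1).2 h2⟩

lemma two_le_card_Λ (h : S.Enum τ) {f : Fin n} (hf : ∀ m, ¬ IsMax (S.X (τ m)) f) : 2 ≤ (Λ S τ f).card := by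
  have hk := S.two_le
  obtain ⟨q, h1, h2⟩ := h.exists_loss f k
  obtain ⟨θ, hθ⟩ := h.exists_isMax (q - 1)
  obtain ⟨p, h3, h4, h5⟩ := h.exists_pred_loss h1 h2 (by rintro rfl; exact hf _ hθ) hθ
  refine Finset.one_lt_card.2 ⟨_, (h.mem_Λ (by omega)).2 h2, _,
    (h.mem_Λ (by omega)).2 h5.mem_L, (h.mod_ne h3 h4).symm⟩

lemma sum_card_Λ (h : S.Enum τ) : ∑ f, (Λ S τ f).card = k * k := by
  classical
  have h1 : ∀ f, (Λ S τ f).card = ∑ c ∈ Finset.range k, if f ∈ S.L (τ (k + c)) then 1 else 0 :=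
    fun f => by rw [Λ, Finset.card_filter]
  simp_rw [h1]
  rw [Finset.sum_comm]
  have h2 : ∀ c, (∑ f, if f ∈ S.L (τ (k + c)) then 1 else 0) = k := fun c => by
    rw [← Finset.card_filter, Finset.filter_univ_mem]
    exact card_L (h.T₂_lt _) (h.trans _)
  simp [h2]

lemma card_isMax (h : S.Enum τ) [DecidablePred fun f => ∃ m, IsMax (S.X (τ m)) f] :
    (Finset.univ.filter fun f : Fin n => ∃ m, IsMax (S.X (τ m)) f).card = k := by
  choose θ hθ using h.exists_isMax
  refine Eq.trans ?_ S.card_R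
  symm
  have hx : ∀ P ∈ S.R, ∃ i, IsMax P i := fun P hP => by
    obtain ⟨m, -, -, rfl⟩ := h.exists_X_eq 0 hP
    exact ⟨_, hθ m⟩
  refine Finset.card_bij (fun P hP => (hx P hP).choose) ?_ ?_ ?_
  · intro P hP
    obtain ⟨m, -, -, hm⟩ := h.exists_X_eq 0 hP
    refine Finset.mem_filter.2 ⟨Finset.mem_univ _, m, ?_⟩
    rw [hm]
    exact (hx P hP).choose_spec
  · intro P hP P' hP' he
    exact IsMax.eq hP hP' (hx P hP).choose_spec (he ▸ (hx P' hP').choose_spec)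
  · intro f hf
    obtain ⟨m, hm⟩ := (Finset.mem_filter.1 hf).2
    exact ⟨_, h.mem_R m, (hx _ (h.mem_R m)).choose_spec.unique hm⟩

/-- The maxima lose once per period, all other functions twice. -/
lemma card_Λ (h : S.Enum τ) [DecidablePred fun f => ∃ m, IsMax (S.X (τ m)) f] (f : Fin n) :
    (Λ S τ f).card = if ∃ m, IsMax (S.X (τ m)) f then 1 else 2 := by
  have hle : ∀ f ∈ Finset.univ, (if ∃ m, IsMax (S.X (τ m)) f then 1 else 2) ≤ (Λ S τ f).card := by
    intro f _
    split_ifs with hf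
    · exact h.one_le_card_Λ f
    · exact h.two_le_card_Λ (not_exists.1 hf)
  have hsum : (∑ f : Fin n, if ∃ m, IsMax (S.X (τ m)) f then 1 else 2) = ∑ f, (Λ S τ f).card := by
    have e1 : (∑ f : Fin n, if ∃ m, IsMax (S.X (τ m)) f then 1 else 2) +
        ∑ f : Fin n, (if ∃ m, IsMax (S.X (τ m)) f then 1 else 0) = n * 2 := by
      rw [← Finset.sum_add_distrib]
      have : ∀ f : Fin n, (if ∃ m, IsMax (S.X (τ m)) f then 1 else 2) +
          (if ∃ m, IsMax (S.X (τ m)) f then 1 else 0) = 2 := fun f => by split_ifs <;> rfl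
      simp [this]
    rw [← Finset.card_filter, h.card_isMax] at e1
    have e2 : n * 2 = k * k + k := by
      rw [S.card_eq, Nat.choose_two_right, Nat.div_mul_cancel (Nat.even_mul_pred_self _).two_dvd]
      simp only [Nat.add_sub_cancel]
      ring
    rw [h.sum_card_Λ]
    omega
  exact ((Finset.sum_eq_sum_iff_of_le hle).1 hsum f (Finset.mem_univ _)).symm

lemma mod_eq_of_isMax (h : S.Enum τ) {θ : Fin n} {m p q : ℕ} (hθ : IsMax (S.X (τ m)) θ) (hp : 1 ≤ p) (hq : 1 ≤ q)
    (h1 : θ ∈ S.L (τ p)) (h2 : θ ∈ S.L (τ q)) : p % k = q % k := by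
  classical
  have h3 := h.card_Λ θ
  rw [if_pos ⟨m, hθ⟩] at h3
  exact Finset.card_le_one.1 h3.le _ ((h.mem_Λ hp).2 h1) _ ((h.mem_Λ hq).2 h2)

/-- A function with two consecutive losses in a period is never the maximum, and it loses exactly
at the corresponding residues. -/
lemma Λ_of_edge (h : S.Enum τ) {p q : ℕ} (hp : 1 ≤ p) (hpq : p < q) (hqp : q < p + k) {j : Fin n}
    (h1 : j ∈ S.L (τ p)) (h2 : j ∈ S.L (τ q)) : (∀ m, ¬ IsMax (S.X (τ m)) j) ∧
      ∀ m, 1 ≤ m → (j ∈ S.L (τ m) ↔ m % k = p % k ∨ m % k = q % k) := by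
  classical
  have hne : p % k ≠ q % k := h.mod_ne hpq hqp
  have hmax : ∀ m, ¬ IsMax (S.X (τ m)) j := fun m hm =>
    hne (h.mod_eq_of_isMax hm hp (by omega) h1 h2)
  refine ⟨hmax, fun m hm => ?_⟩
  have h3 := h.card_Λ j
  rw [if_neg (not_exists.2 hmax)] at h3
  have h4 : {p % k, q % k} = Λ S τ j := by
    refine Finset.eq_of_subset_of_card_le ?_ ?_
    · intro c hc
      rcases Finset.mem_insert.1 hc with rfl | hc
      · exact (h.mem_Λ hp).2 h1
      · rw [Finset.mem_singleton.1 hc]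
        exact (h.mem_Λ (by omega)).2 h2
    · rw [h3, Finset.card_pair hne]
  rw [← h.mem_Λ hm, ← h4, Finset.mem_insert, Finset.mem_singleton]

/-- Every jump of a never maximal function is a loss. -/
lemma exists_loss_of_drops (h : S.Enum τ) {j : Fin n} (hj : ∀ m, ¬ IsMax (S.X (τ m)) j) {b : ℕ} (hb : τ k < b)
    (hd : Drops (S.f j) b) : ∃ q, b = τ q ∧ j ∈ S.L (τ q) := by
  classical
  have hex : ∃ q, b ≤ τ q ∧ j ∈ S.L (τ q) := by
    obtain ⟨q, h1, h2⟩ := h.exists_loss j b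
    exact ⟨q, h1.trans (h.mono.id_le q), h2⟩
  obtain ⟨h1, h2⟩ := Nat.find_spec hex
  set q := Nat.find hex with hq
  have hkq := h.mono.lt_iff_lt.1 (hb.trans_le h1)
  obtain ⟨θ, hθ⟩ := h.exists_isMax (q - 1)
  obtain ⟨p, h3, h4, h5⟩ := h.exists_pred_loss hkq.le h2 (by rintro rfl; exact hj _ hθ) hθ
  have h6 := Nat.find_min hex h3
  refine ⟨q, le_antisymm h1 (h5.consec.le_of_drops hd ?_), h2⟩
  by_contra hcon
  exact h6 ⟨by omega, h5.mem_L⟩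

/-- Consecutive losses of a function that is never maximal are consecutive jumps. -/
lemma edge_of_loss (h : S.Enum τ) {j θ : Fin n} (hj : ∀ m, ¬ IsMax (S.X (τ m)) j) {p q : ℕ} (hq : k ≤ q)
    (hpq : p < q) (h1 : j ∈ S.L (τ p)) (h2 : j ∈ S.L (τ q))
    (hm : ∀ m, p < m → m < q → j ∉ S.L (τ m)) (hθ : IsMax (S.X (τ (q - 1))) θ) :
    S.Edge j θ (τ p) (τ q) := by
  obtain ⟨p', h3, h4, h5⟩ := h.exists_pred_loss hq h2 (by rintro rfl; exact hj _ hθ) hθ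
  have h6 : p' ≤ p := by
    by_contra hcon
    exact hm p' (by omega) h3 h5.mem_L
  rcases eq_or_lt_of_le h6 with rfl | h7
  · exact h5
  · have h8 := h5.consec.le_of_drops (drops_of_mem_L (h.two_le p) h1) (h.mono h7)
    exact absurd (h.mono.le_iff_le.1 h8) (by omega)

end Enum

end StairSys

namespace StairSys

variable {n k : ℕ} {S : StairSys n k}

/-- The functions, indexed by the residues (counted from `M + 1`) at which they lose. -/
structure Grid (S : StairSys n k) (τ : ℕ → ℕ) (M : ℕ) (F : ℕ → ℕ → Fin n) : Prop where
  enum : S.Enum τ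
  le : 4 * k ≤ M
  isMax : ∀ i < k, IsMax (S.X (τ (M + i))) (F i i)
  mem : ∀ i j, i < j → j < k → F i j ∈ S.L (τ (M + i + 1))
  edge : ∀ i j, i < j → j < k → S.Edge (F i j) (F i i) (τ (M + j + 1 - k)) (τ (M + i + 1))

lemma Enum.exists_grid {τ : ℕ → ℕ} (h : S.Enum τ) {M : ℕ} (hM : 4 * k ≤ M) :
    ∃ F, S.Grid τ M F := by
  choose θ hθ using h.exists_isMax
  have hex : ∀ i j, ∃ f, i < j → j < k → f ∈ S.L (τ (M + i + 1)) ∧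
      S.Edge f (θ (M + i)) (τ (M + j + 1 - k)) (τ (M + i + 1)) := by
    intro i j
    by_cases hij : i < j ∧ j < k
    · obtain ⟨f, hf⟩ := h.exists_edge_of_gap (p := M + j + 1 - k) (q := M + i + 1)
        (by omega) (by omega) (by omega) (hθ (M + i))
      exact ⟨f, fun _ _ => hf⟩
    · exact ⟨θ 0, fun h1 h2 => absurd ⟨h1, h2⟩ hij⟩
  choose F hF using hex
  refine ⟨fun i j => if i = j then θ (M + i) else F i j, h, hM, fun i _ => ?_,
    fun i j hij hj => ?_, fun i j hij hj => ?_⟩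
  · simpa using hθ (M + i)
  · simpa [hij.ne] using (hF i j hij hj).1
  · simpa [hij.ne] using (hF i j hij hj).2

namespace Grid

variable {τ : ℕ → ℕ} {M : ℕ} {F : ℕ → ℕ → Fin n}

lemma losses (h : S.Grid τ M F) {i j : ℕ} (hij : i < j) (hj : j < k) :
    (∀ m, ¬ IsMax (S.X (τ m)) (F i j)) ∧ ∀ m, 1 ≤ m →
      (F i j ∈ S.L (τ m) ↔ m % k = (M + i + 1) % k ∨ m % k = (M + j + 1) % k) := by
  have h0 := h.le
  obtain ⟨h1, h2⟩ := h.enum.Λ_of_edge (by omega) (by omega) (by omega) (h.edge i j hij hj).mem_L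
    (h.mem i j hij hj)
  have h3 : (M + j + 1 - k) % k = (M + j + 1) % k := (Nat.mod_eq_sub_mod (by omega)).symm
  refine ⟨h1, fun m hm => ?_⟩
  rw [h2 m hm, h3, or_comm]

lemma edge_right (h : S.Grid τ M F) {i j : ℕ} (hij : i < j) (hj : j < k) :
    S.Edge (F i j) (F j j) (τ (M + i + 1)) (τ (M + j + 1)) := by
  have h0 := h.le
  obtain ⟨h1, h2⟩ := h.losses hij hj
  refine h.enum.edge_of_loss h1 (by omega) (by omega) ((h2 _ (by omega)).2 (Or.inl rfl))
    ((h2 _ (by omega)).2 (Or.inr rfl)) (fun m h3 h4 h5 => ?_) (h.isMax j hj)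
  rcases (h2 m (by omega)).1 h5 with h6 | h6
  · exact h.enum.mod_ne h3 (by omega) h6.symm
  · exact h.enum.mod_ne h4 (by omega) h6

lemma lt_diag (h : S.Grid τ M F) {i j : ℕ} (hij : i < j) (hj : j < k) :
    S.f (F i j) (τ M) < S.f (F i i) (τ M) :=
  (h.edge i j hij hj).after _ (h.enum.mono.monotone (by omega)) (h.enum.mono (by omega))

lemma diag_lt (h : S.Grid τ M F) {i : ℕ} (hi : i + 1 < k) :
    S.f (F (i + 1) (i + 1)) (τ M) < S.f (F i (i + 1)) (τ M) := by
  have h0 := h.le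
  have h1 := (h.edge_right (Nat.lt_add_one i) hi).before
  have hlt := h.enum.mono (Nat.lt_add_one (M + i))
  have hpos := h.enum.T₁_lt (M + i)
  have hne : F (i + 1) (i + 1) ≠ F i (i + 1) := by
    intro he
    rw [he] at h1
    exact lt_irrefl _ h1
  refine (lt_or_gt (S := S) (h.enum.T₁_lt M).le hne).resolve_right fun h2 => ?_
  obtain ⟨v, h3, h4, h5, h6⟩ := exists_first_switch
    (p := fun v => S.X (τ v) (F i (i + 1)) (F (i + 1) (i + 1))) (u := M) (w := M + i) h2
    (fun h7 => by
      rw [← h.enum.X_pred] at h7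
      exact lt_asymm h1 h7) (by omega)
  have h7 : F (i + 1) (i + 1) ∈ S.L (τ v) := by
    have h8 := h6 (v - 1) (by omega) (by omega)
    rw [show v = v - 1 + 1 by omega] at h5 ⊢
    exact h.enum.mem_L_iff.2
      ⟨_, h8, (lt_or_gt (S := S) (h.enum.T₁_lt _).le hne).resolve_right h5⟩
  have hmax := h.isMax (i + 1) hi
  have h8 : F (i + 1) (i + 1) ∈ S.L (τ (M + (i + 1) + 1)) := by
    obtain ⟨i₀, h9, h10, -⟩ := trans_structure (h.enum.T₂_lt _) (h.enum.trans (M + (i + 1) + 1))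
    rw [h.enum.X_pred] at h10
    rwa [hmax.unique h10]
  exact h.enum.mod_ne (by omega : v < M + (i + 1) + 1) (by omega)
    (h.enum.mod_eq_of_isMax hmax (by omega) (by omega) h7 h8)

lemma lt_succ (h : S.Grid τ M F) {i j : ℕ} (hij : i < j) (hj : j + 1 < k) :
    S.f (F i j) (τ M) < S.f (F i (j + 1)) (τ M) := by
  have h0 := h.le
  have A₁ := (h.edge i j hij (by omega)).consec
  have A₂ := (h.edge_right hij (by omega)).consec
  have B₁ := (h.edge i (j + 1) (by omega) hj).consec
  have B₂ := (h.edge_right (by omega : i < j + 1) hj).consec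
  have C₁ := (h.edge j (j + 1) (by omega) hj).consec
  have C₂ := (h.edge_right (by omega : j < j + 1) hj).consec
  have ha := h.enum.two_le (M + j + 1 - k)
  have haM : τ (M + j + 1 - k) ≤ τ M := h.enum.mono.monotone (by omega)
  have haM' : τ (M + (j + 1) + 1 - k) ≤ τ M := h.enum.mono.monotone (by omega)
  have hMb : τ M < τ (M + i + 1) := h.enum.mono (by omega)
  have hbc : τ (M + i + 1) < τ (M + j + 1) := h.enum.mono (by omega)
  rw [A₁.const haM hMb, B₁.const haM' hMb]
  generalize τ (M + j + 1 - k) = a at *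
  generalize τ (M + (j + 1) + 1 - k) = a' at *
  generalize τ (M + i + 1) = b at *
  generalize τ (M + j + 1) = c at *
  generalize τ (M + (j + 1) + 1) = d at *
  have hd : b * c ≤ d := by
    obtain ⟨m, hm, e1⟩ := (S.stair _).recur _ _ _ B₁ B₂
    obtain ⟨m', -, e2⟩ := (S.stair _).recur _ _ _ C₁ C₂
    have e3 : m * b = m' * c := by omega
    have e4 : c ∣ m := ((S.stair _).coprime _ _ A₂).symm.dvd_of_dvd_mul_right ⟨m', by rw [e3, mul_comm]⟩
    have e5 := Nat.mul_le_mul_right b (Nat.le_of_dvd hm e4)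
    rw [mul_comm] at e5
    omega
  have d1 := (S.stair _).det _ _ A₁
  have d2 := (S.stair _).det _ _ A₂
  have d3 := (S.stair _).det _ _ B₁
  have d4 := (S.stair _).mul_right_lt_one B₂
  have v1 := A₂.value_lt
  generalize S.f (F i j) a = Aa at *
  generalize S.f (F i j) c = Ac at *
  generalize S.f (F i (j + 1)) a' = Ba at *
  have hB := (S.stair (F i (j + 1))).pos b (by omega)
  generalize S.f (F i (j + 1)) b = Bb at *
  have hb : (0 : ℝ) < b := by exact_mod_cast (by omega : 0 < b)
  have hc : (b : ℝ) < c := by exact_mod_cast hbc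
  have ha' : (a' : ℝ) < b := by exact_mod_cast (by omega : a' < b)
  have ha2 : (2 : ℝ) ≤ a := by exact_mod_cast ha
  have hd' : (b : ℝ) * c ≤ d := by exact_mod_cast hd
  have hA := (S.stair (F i j)).pos b (by omega)
  generalize S.f (F i j) b = Ab at *
  have i1 : 1 < 2 * (Ab * c) := by
    have h1 := mul_lt_mul_of_pos_right v1 hb
    have h2 := mul_lt_mul_of_pos_left hc hA
    linarith
  have i2 : Bb * (b * c) < 1 := (mul_le_mul_of_nonneg_left hd' hB.le).trans_lt d4
  have i3 : Bb * a' < Ab * a := by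
    have hbc' : (0 : ℝ) < b * c := mul_pos hb (hb.trans hc)
    refine lt_of_mul_lt_mul_right ?_ hbc'.le
    calc Bb * a' * (b * c) = Bb * (b * c) * a' := by ring
      _ ≤ 1 * a' := mul_le_mul_of_nonneg_right i2.le (Nat.cast_nonneg _)
      _ < 1 * b := by linarith
      _ < 2 * (Ab * c) * b := mul_lt_mul_of_pos_right i1 hb
      _ = 2 * (Ab * b * c) := by ring
      _ ≤ a * (Ab * b * c) := by
        refine mul_le_mul_of_nonneg_right ha2 ?_
        rw [mul_assoc]
        exact (mul_pos hA hbc').le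
      _ = Ab * a * (b * c) := by ring
  exact lt_of_mul_lt_mul_right (by linarith : Aa * b < Ba * b) hb.le

end Grid

end StairSys

lemma start_succ {k i : ℕ} (hi : i < k) :
    (i + 1) * k - (i + 1) * (i + 1 - 1) / 2 = i * k - i * (i - 1) / 2 + (k - i) := by
  rw [← Nat.choose_two_right, ← Nat.choose_two_right, Nat.choose_succ_succ' i 1,
    Nat.choose_one_right, Nat.succ_mul]
  have h1 : i.choose (1 + 1) ≤ i * k := by
    rw [Nat.choose_two_right]
    exact (Nat.div_le_self _ _).trans (Nat.mul_le_mul_left i (by omega))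
  change i * k + k - (i + i.choose (1 + 1)) = i * k - i.choose (1 + 1) + (k - i)
  omega

lemma start_le {k i i' : ℕ} (hi : i < i') (hi' : i' < k) :
    i * k - i * (i - 1) / 2 + (k - i) ≤ i' * k - i' * (i' - 1) / 2 := by
  induction i', hi using Nat.le_induction with
  | base => exact (start_succ (by omega)).ge
  | succ m hm ih =>
    rw [start_succ (by omega)]
    exact (ih (by omega)).trans (Nat.le_add_right _ _)

/-- The enumeration of positions is lexicographic. -/
lemma posIdx_lt {k : ℕ} {p q : PairIdx k} (h : posIdx p < posIdx q) :
    p.1.1.val < q.1.1.val ∨ p.1.1.val = q.1.1.val ∧ q.1.1.val < q.1.2.val ∧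
      (p.1.2.val = p.1.1.val ∨ q.1.2.val < p.1.2.val) := by
  obtain ⟨⟨⟨i, hi⟩, ⟨j, hj⟩⟩, hij⟩ := p
  obtain ⟨⟨⟨i', hi'⟩, ⟨j', hj'⟩⟩, hij'⟩ := q
  replace hij : i ≤ j := hij
  replace hij' : i' ≤ j' := hij'
  simp only [posIdx] at h ⊢
  rcases lt_trichotomy i i' with h1 | h1 | h1
  · exact Or.inl h1
  · subst h1
    right
    split_ifs at h <;> omega
  · exfalso
    have := start_le h1 hi
    split_ifs at h <;> omega

lemma posIdx_injective {k : ℕ} : Function.Injective (posIdx : PairIdx k → ℕ) := by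
  rintro ⟨⟨⟨i, hi⟩, ⟨j, hj⟩⟩, hij⟩ ⟨⟨⟨i', hi'⟩, ⟨j', hj'⟩⟩, hij'⟩ h
  replace hij : i ≤ j := hij
  replace hij' : i' ≤ j' := hij'
  simp only [posIdx] at h
  have e : i = i' ∧ j = j' := by
    rcases lt_trichotomy i i' with h1 | h1 | h1
    · have := start_le h1 hi'
      split_ifs at h <;> omega
    · subst h1
      split_ifs at h <;> omega
    · have := start_le h1 hi
      split_ifs at h <;> omega
  obtain ⟨rfl, rfl⟩ := e
  rfl

section Chain

variable {k : ℕ} {G : ℕ → ℕ → ℝ}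

lemma chain_row_le (h3 : ∀ i j, i < j → j + 1 < k → G i j < G i (j + 1)) {i j j' : ℕ}
    (hij : i < j) (hj : j ≤ j') (hj' : j' < k) : G i j ≤ G i j' := by
  induction j', hj using Nat.le_induction with
  | base => exact le_rfl
  | succ m hm ih => exact (ih (by omega)).trans (h3 i m (by omega) hj').le

lemma chain_row_lt (h3 : ∀ i j, i < j → j + 1 < k → G i j < G i (j + 1)) {i j j' : ℕ}
    (hij : i < j) (hj : j < j') (hj' : j' < k) : G i j < G i j' :=
  (h3 i j hij (by omega)).trans_le (chain_row_le h3 (by omega) hj hj')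

lemma chain_diag_lt (h1 : ∀ i j, i < j → j < k → G i j < G i i)
    (h2 : ∀ i, i + 1 < k → G (i + 1) (i + 1) < G i (i + 1))
    (h3 : ∀ i j, i < j → j + 1 < k → G i j < G i (j + 1)) {i j i' : ℕ} (hi : i < i')
    (hi' : i' < k) (hij : i ≤ j) (hj : j < k) : G i' i' < G i j := by
  induction i', hi using Nat.le_induction with
  | base =>
    refine (h2 i hi').trans_le ?_
    rcases eq_or_lt_of_le hij with rfl | h
    · exact (h1 _ _ (by omega) hi').le
    · exact chain_row_le h3 (by omega) h hj
  | succ m hm ih =>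
    exact ((h2 m hi').trans (h1 _ _ (by omega) hi')).trans (ih (by omega))

lemma chain_lt (h1 : ∀ i j, i < j → j < k → G i j < G i i)
    (h2 : ∀ i, i + 1 < k → G (i + 1) (i + 1) < G i (i + 1))
    (h3 : ∀ i j, i < j → j + 1 < k → G i j < G i (j + 1)) {p q : PairIdx k}
    (h : posIdx p < posIdx q) : G q.1.1 q.1.2 < G p.1.1 p.1.2 := by
  have hp : p.1.1.val ≤ p.1.2.val := p.2
  have hq : q.1.1.val ≤ q.1.2.val := q.2
  have hpk := p.1.2.isLt
  have hqk := q.1.2.isLt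
  rcases posIdx_lt h with h4 | ⟨h4, h5, h6⟩
  · have h7 := chain_diag_lt h1 h2 h3 h4 (by omega) hp hpk
    rcases eq_or_lt_of_le hq with h8 | h8
    · rwa [← h8]
    · exact (h1 _ _ h8 hqk).trans h7
  · rw [h4] at h6 ⊢
    rcases h6 with h6 | h6
    · rw [h6]
      exact h1 _ _ h5 hqk
    · exact chain_row_lt h3 h5 h6 hpk

end Chain

lemma eq_of_strictAnti_comp {β ι : Type*} [LinearOrder β] [Finite β] {g : ι → ℝ} {v w : β → ι}
    (hg : Function.Injective g) (hv : Function.Surjective v) (hw : Function.Surjective w)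
    (hgv : ∀ p q, p < q → g (v q) < g (v p)) (hgw : ∀ p q, p < q → g (w q) < g (w p)) :
    v = w := by
  have h1 : StrictMono fun p => -g (v p) := fun p q h => neg_lt_neg (hgv p q h)
  have h2 : StrictMono fun p => -g (w p) := fun p q h => neg_lt_neg (hgw p q h)
  have h3 : Set.range (fun p => -g (v p)) = Set.range fun p => -g (w p) :=
    (hv.range_comp fun i => -g i).trans (hw.range_comp fun i => -g i).symm
  funext p
  exact hg (neg_injective (congrFun ((h1.range_inj h2).1 h3) p))

lemma posIdx_unique {n k : ℕ} {g : Fin n → ℝ} {v w : PairIdx k → Fin n}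
    (hg : Function.Injective g) (hv : Function.Bijective v)
    (hgv : ∀ p q, posIdx p < posIdx q → g (v q) < g (v p))
    (hgw : ∀ p q, posIdx p < posIdx q → g (w q) < g (w p)) : v = w := by
  let _ : LinearOrder (PairIdx k) := LinearOrder.lift' posIdx posIdx_injective
  have hfin : Finite (PairIdx k) := Finite.of_injective v hv.1
  have hw : Function.Injective w := by
    have : StrictMono fun p => -g (w p) := fun p q h => neg_lt_neg (hgw p q h)
    intro p q h
    exact this.injective (congrArg (fun i => -g i) h)
  have hw' : Function.Surjective w := by
    have e := Equiv.ofBijective v hv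
    have h1 : Function.Surjective (w ∘ e.symm) :=
      Finite.surjective_of_injective (hw.comp e.symm.injective)
    exact h1.of_comp
  exact eq_of_strictAnti_comp hg hv.2 hw' hgv hgw

lemma psi_eq_of_mem_Ico (α : ℝ) {N : ℕ} {u : ℝ} (h1 : (N : ℝ) ≤ u) (h2 : u < N + 1) :
    psi α u = psi α N := by
  rw [IsStair.psi_eq_floor α ((Nat.cast_nonneg N).trans h1),
    (Nat.floor_eq_iff ((Nat.cast_nonneg N).trans h1)).2 ⟨h1, h2⟩]

lemma psi_continuousAt {α t : ℝ} (ht : 2 ≤ t)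
    (h : ∀ N : ℕ, (N : ℝ) = t → ¬ Drops (fun N : ℕ => psi α N) N) : ContinuousAt (psi α) t := by
  have h0 : (0 : ℝ) ≤ t := by linarith
  set N := ⌊t⌋₊ with hN
  have h1 : (N : ℝ) ≤ t := Nat.floor_le h0
  have h2 : t < N + 1 := Nat.lt_floor_add_one t
  have hN2 : 2 ≤ N := Nat.le_floor (by exact_mod_cast ht)
  obtain ⟨a, ha, hc⟩ : ∃ a < t, ∀ u, a < u → u < N + 1 → psi α u = psi α N := by
    rcases eq_or_lt_of_le h1 with h3 | h3
    · refine ⟨(N - 1 : ℕ), h3 ▸ Nat.cast_lt.2 (by omega), fun u h4 h5 => ?_⟩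
      rcases le_or_gt (N : ℝ) u with h6 | h6
      · exact psi_eq_of_mem_Ico α h6 h5
      · have h7 : ((N - 1 : ℕ) : ℝ) + 1 = N := by exact_mod_cast (by omega : N - 1 + 1 = N)
        rw [psi_eq_of_mem_Ico α h4.le (by rwa [h7])]
        have h8 := h N h3
        simp only [Drops, not_and, not_lt] at h8
        exact le_antisymm (h8 hN2) (IsStair.psi_anti α (by omega) (by omega))
    · exact ⟨N, h3, fun u h4 h5 => psi_eq_of_mem_Ico α h4.le h5⟩
  refine ContinuousAt.congr (f := fun _ => psi α N) continuousAt_const ?_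
  filter_upwards [Ioo_mem_nhds ha h2] with u hu
  exact (hc u hu.1 hu.2).symm

lemma psi_not_continuousAt {α : ℝ} {N : ℕ} (h : Drops (fun N : ℕ => psi α N) N) :
    ¬ ContinuousAt (psi α) N := by
  intro hc
  obtain ⟨h1, h2⟩ := h
  have h3 : ((N - 1 : ℕ) : ℝ) + 1 = N := by exact_mod_cast (by omega : N - 1 + 1 = N)
  have h4 := (hc.eventually_lt (continuousAt_const (y := psi α (N - 1 : ℕ))) h2).filter_mono
    (nhdsWithin_le_nhds (s := Set.Iio (N : ℝ)))
  obtain ⟨u, hu, hu1, hu2⟩ := (h4.and (Ico_mem_nhdsLT (by linarith :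
    ((N - 1 : ℕ) : ℝ) < N))).exists
  exact hu.ne (psi_eq_of_mem_Ico α hu1 (by rwa [h3]))

section OrderVec

variable {n : ℕ} {α : Fin n → ℝ}

/-- The relative order at the integer time `N`. -/
def relAt (α : Fin n → ℝ) (N : ℕ) : Fin n → Fin n → Prop := fun i j => psi (α i) N < psi (α j) N

/-- The relative order encoded by an order vector. -/
def relOf (v : Fin n → Fin n) : Fin n → Fin n → Prop := fun i j => ∃ q p, q < p ∧ v q = j ∧ v p = i

lemma relAt_floor {t : ℝ} (ht : 0 ≤ t) (i j : Fin n) :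
    relAt α ⌊t⌋₊ i j ↔ psi (α i) t < psi (α j) t := by
  rw [IsStair.psi_eq_floor (α i) ht, IsStair.psi_eq_floor (α j) ht]
  rfl

lemma IsOrderVec.relOf_eq {t : ℝ} (ht : 0 ≤ t) {v : Fin n → Fin n} (h : IsOrderVec α t v) :
    relOf v = relAt α ⌊t⌋₊ := by
  funext i j
  rw [relAt_floor ht]
  refine propext ⟨?_, fun hij => ?_⟩
  · rintro ⟨q, p, h1, rfl, rfl⟩
    exact h.2 q p h1
  · obtain ⟨p, rfl⟩ := h.1.2 i
    obtain ⟨q, rfl⟩ := h.1.2 j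
    refine ⟨q, p, ?_, rfl, rfl⟩
    by_contra hcon
    rcases eq_or_lt_of_le (not_lt.1 hcon) with rfl | h1
    · exact lt_irrefl _ hij
    · exact lt_asymm hij (h.2 p q h1)

lemma IsOrderVec.congr {t t' : ℝ} (ht : 0 ≤ t) (ht' : 0 ≤ t') {v : Fin n → Fin n}
    (h : IsOrderVec α t v) (hX : relAt α ⌊t⌋₊ = relAt α ⌊t'⌋₊) : IsOrderVec α t' v := by
  refine ⟨h.1, fun p q hpq => ?_⟩
  have h1 := (relAt_floor ht _ _).2 (h.2 p q hpq)
  rw [hX] at h1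
  exact (relAt_floor ht' _ _).1 h1

lemma IsOrderVec.injective {t : ℝ} {v : Fin n → Fin n} (h : IsOrderVec α t v) :
    Function.Injective fun i => psi (α i) t := by
  intro i j hij
  obtain ⟨p, rfl⟩ := h.1.2 i
  obtain ⟨q, rfl⟩ := h.1.2 j
  rcases lt_trichotomy p q with h1 | h1 | h1
  · exact absurd hij (h.2 p q h1).ne'
  · rw [h1]
  · exact absurd hij (h.2 q p h1).ne

lemma IsOrderVec.unique {t : ℝ} {v w : Fin n → Fin n} (h : IsOrderVec α t v)
    (h' : IsOrderVec α t w) : v = w :=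
  eq_of_strictAnti_comp h.injective h.1.2 h'.1.2 h.2 h'.2

lemma exists_isOrderVec {t : ℝ} (h : Function.Injective fun i => psi (α i) t) :
    ∃ v, IsOrderVec α t v := by
  set g : Fin n → ℝ := fun i => -psi (α i) t with hg
  refine ⟨Tuple.sort g, (Tuple.sort g).bijective, fun p q hpq => ?_⟩
  have h1 := Tuple.monotone_sort g hpq.le
  refine lt_of_le_of_ne (neg_le_neg_iff.1 h1) fun he => hpq.ne' ?_
  exact (Tuple.sort g).injective (h he)

/-- The relative orders occurring at arbitrarily large times. -/
def orders (α : Fin n → ℝ) : Set (Fin n → Fin n → Prop) :=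
  {P | ∀ T, ∃ N, T ≤ N ∧ relAt α N = P}

lemma ncard_orders (hind : PairwiseIndependent α) : (orders α).ncard = kAlpha α := by
  obtain ⟨T, hT, hne⟩ := hind
  have himg : orders α = relOf '' {v | OccursInfinitely α v} := by
    ext P
    constructor
    · intro hP
      obtain ⟨N, h1, h2⟩ := hP ⌈T⌉₊
      obtain ⟨v, hv⟩ := exists_isOrderVec (α := α) (t := N) (fun i j hij => by
        by_contra h3
        exact hne N ((Nat.le_ceil T).trans (Nat.cast_le.2 h1)) i j h3 hij)
      refine ⟨v, fun T' => ?_, ?_⟩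
      · obtain ⟨N', h3, h4⟩ := hP (⌈T'⌉₊ + 1)
        refine ⟨N', ?_, hv.congr (Nat.cast_nonneg _) (Nat.cast_nonneg _) ?_⟩
        · exact (Nat.le_ceil T').trans_lt (Nat.cast_lt.2 h3)
        · rw [Nat.floor_natCast, Nat.floor_natCast, h2, h4]
      · rw [hv.relOf_eq (Nat.cast_nonneg _), Nat.floor_natCast, h2]
    · rintro ⟨v, hv, rfl⟩ T'
      obtain ⟨t, h1, h2⟩ := hv T'
      have h3 : (0 : ℝ) ≤ t := (Nat.cast_nonneg T').trans h1.le
      exact ⟨⌊t⌋₊, Nat.le_floor h1.le, (h2.relOf_eq h3).symm⟩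
  rw [himg]
  refine Set.InjOn.ncard_image fun v hv w hw hvw => ?_
  obtain ⟨t, h1, h2⟩ := hv 0
  obtain ⟨t', h1', h2'⟩ := hw 0
  refine h2.unique (h2'.congr h1'.le h1.le ?_)
  rw [← h2.relOf_eq h1.le, ← h2'.relOf_eq h1'.le, hvw]

lemma exists_stairSys {k : ℕ} (hk : 2 ≤ k) (hn : n = k * (k + 1) / 2)
    (hirr : ∀ i, Irrational (α i)) (hind : PairwiseIndependent α) (hka : kAlpha α = k) :
    ∃ S : StairSys n k, ∀ i N, S.f i N = psi (α i) N := by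
  classical
  have hst : ∀ i, IsStair fun N : ℕ => psi (α i) N := fun i => IsStair.psi_isStair (hirr i)
  obtain ⟨T, hT, hne⟩ := id hind
  have hne' : ∀ N : ℕ, ⌈T⌉₊ ≤ N → ∀ i j, i ≠ j → psi (α i) N ≠ psi (α j) N := fun N h =>
    hne N ((Nat.le_ceil T).trans (Nat.cast_le.2 h))
  have hR : ∀ᶠ N in Filter.atTop, relAt α N ∈ orders α := by
    have h1 : ∀ P, ∀ᶠ N in Filter.atTop, relAt α N = P → P ∈ orders α := by
      intro P
      by_cases hP : P ∈ orders α
      · exact Filter.Eventually.of_forall fun _ _ => hP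
      · simp only [orders, Set.mem_ofPred_eq, not_forall, not_exists, not_and] at hP
        obtain ⟨T', hT'⟩ := hP
        exact Filter.eventually_atTop.2 ⟨T', fun N h1 h2 => absurd h2 (hT' N h1)⟩
    filter_upwards [Filter.eventually_all.2 h1] with N hN
    exact hN _ rfl
  have hU : ∀ᶠ b in Filter.atTop, ∀ i j, i ≠ j → ∀ a, Consec (fun N : ℕ => psi (α i) N) a b →
      ¬ Consec (fun N : ℕ => psi (α j) N) a b := by
    refine Filter.eventually_all.2 fun i => Filter.eventually_all.2 fun j => ?_
    by_cases hij : i = j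
    · exact Filter.Eventually.of_forall fun _ h => absurd hij h
    · obtain ⟨T', hT'⟩ := (hst i).exists_unlinked (hst j) (T := ⌈T⌉₊) fun N h => hne' N h i j hij
      exact Filter.eventually_atTop.2 ⟨T', fun b hb _ a => hT' a b hb⟩
  obtain ⟨T₁, hT₁⟩ := Filter.eventually_atTop.1
    ((hR.and hU).and ((Filter.eventually_ge_atTop ⌈T⌉₊).and (Filter.eventually_ge_atTop 1)))
  have hfin : (orders α).Finite := Set.toFinite _
  have hocc : ∀ P, ∃ N, P ∈ orders α → T₁ ≤ N ∧ relAt α N = P := by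
    intro P
    by_cases hP : P ∈ orders α
    · obtain ⟨N, hN⟩ := hP T₁
      exact ⟨N, fun _ => hN⟩
    · exact ⟨0, fun h => absurd h hP⟩
  choose N hN using hocc
  exact ⟨{
    f := fun i (N : ℕ) => psi (α i) N
    stair := hst
    two_le := hk
    card_eq := by rw [hn, Nat.choose_two_right, Nat.add_sub_cancel, mul_comm]
    T₁ := T₁
    T₂ := hfin.toFinset.sup N + 1
    one_le := (hT₁ T₁ le_rfl).2.2
    ne := fun N h => hne' N (hT₁ N h).2.1
    R := hfin.toFinset
    card_R := by rw [← Set.ncard_eq_toFinset_card, ncard_orders hind, hka]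
    mem_R := fun N h => hfin.mem_toFinset.2 (hT₁ N h).1.1
    occurs := fun P hP => ⟨N P, (hN P (hfin.mem_toFinset.1 hP)).1,
      Nat.lt_succ_of_le (Finset.le_sup hP), (hN P (hfin.mem_toFinset.1 hP)).2⟩
    occurs_inf := fun P hP => hfin.mem_toFinset.1 hP
    unlinked := fun i j hij a b hb => (hT₁ b hb).1.2 i j hij a }, fun _ _ => rfl⟩

lemma sameOrder_iff {t t' : ℝ} (ht : 0 ≤ t) (ht' : 0 ≤ t') :
    SameOrder α t t' ↔ relAt α ⌊t⌋₊ = relAt α ⌊t'⌋₊ := by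
  constructor
  · intro h
    funext i j
    rw [relAt_floor ht, relAt_floor ht']
    exact propext (h i j)
  · intro h i j
    rw [← relAt_floor ht, ← relAt_floor ht', h]

end OrderVec

/-- **Theorem (Main), item (iv).** Each off-diagonal function `ψ_{i,j}` jumps exactly at
the moments `t_{i+sk}` and `t_{j+sk}`, and is continuous at all other points `t ≥ t_i`.
(`0`-based: `i, j` below are the paper's `i - 1, j - 1`.) -/
theorem stmt13 (k : ℕ) (hk : 2 ≤ k) (n : ℕ) (hn : n = k * (k + 1) / 2)
    (α : Fin n → ℝ) (hirr : ∀ i, Irrational (α i)) (hind : PairwiseIndependent α)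
    (hka : kAlpha α = k) :
    ∃ T : ℝ, 1 < T ∧ ∀ t0 : ℝ, T ≤ t0 → ∀ ts : ℕ → ℝ, ts 0 = t0 → IsChangeSeq α ts →
      ∀ e : PairIdx k → Fin n, IsOrderVecP α t0 e →
        ∀ i j : ℕ, ∀ hij : i < j, ∀ hj : j < k,
          (∀ s : ℕ,
            ¬ ContinuousAt (psi (α (e (mkPos i j (le_of_lt hij) hj)))) (ts (i + 1 + s * k)) ∧
            ¬ ContinuousAt (psi (α (e (mkPos i j (le_of_lt hij) hj)))) (ts (j + 1 + s * k))) ∧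
          (∀ t : ℝ, ts (i + 1) ≤ t →
            (∀ s : ℕ, t ≠ ts (i + 1 + s * k) ∧ t ≠ ts (j + 1 + s * k)) →
            ContinuousAt (psi (α (e (mkPos i j (le_of_lt hij) hj)))) t) := by
  obtain ⟨S, hS⟩ := exists_stairSys hk hn hirr hind hka
  obtain ⟨τ, hτ⟩ := S.exists_enum
  have hX : ∀ N, relAt α N = S.X N := fun N => by
    funext i j
    simp only [relAt, StairSys.X, hS]
  refine ⟨τ (4 * k) + 1, by
    have : (2 : ℝ) ≤ τ (4 * k) := by exact_mod_cast hτ.two_le _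
    linarith, fun t0 ht0 ts hts0 hts e he i j hij hj => ?_⟩
  have ht0' : (τ (4 * k) : ℝ) ≤ t0 := by linarith
  have hpos : 0 ≤ t0 := (Nat.cast_nonneg _).trans ht0'
  obtain ⟨M, hM₁, hM₂⟩ := hτ.exists_index
    ((hτ.mono.monotone (Nat.zero_le _)).trans (Nat.le_floor ht0'))
  have hM : 4 * k ≤ M := by
    have := hτ.mono.lt_iff_lt.1 ((Nat.le_floor ht0').trans_lt hM₂)
    omega
  have hrel : ∀ {m : ℕ} {t : ℝ}, (τ m : ℝ) ≤ t → t < τ (m + 1) →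
      relAt α ⌊t⌋₊ = S.X (τ m) := fun {m t} h1 h2 => by
    rw [hX]
    exact hτ.X_eq (Nat.le_floor h1) ((Nat.floor_lt ((Nat.cast_nonneg _).trans h1)).2 h2)
  have hstep : ∀ m, (τ (M + m) : ℝ) ≤ ts m → ts m < τ (M + m + 1) →
      ts (m + 1) = τ (M + m + 1) := by
    intro m h1 h2
    have h0 : 0 ≤ ts m := (Nat.cast_nonneg _).trans h1
    refine (hts m).unique ⟨⟨h2, fun h3 => ?_⟩, fun t ht => ?_⟩
    · rw [sameOrder_iff h0 (Nat.cast_nonneg _), hrel h1 h2, Nat.floor_natCast, hX] at h3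
      exact hτ.X_ne (Nat.lt_add_one _) (by omega) h3
    · obtain ⟨h3, h4⟩ := ht
      refine not_lt.1 fun h5 => h4 ?_
      have h6 := h1.trans h3.le
      rw [sameOrder_iff h0 ((Nat.cast_nonneg _).trans h6), hrel h1 h2, hrel h6 h5]
  have hts' : ∀ m, ts (m + 1) = τ (M + m + 1) := by
    intro m
    induction m with
    | zero =>
      refine hstep 0 ?_ ?_ <;> rw [hts0]
      · exact (Nat.cast_le.2 hM₁).trans (Nat.floor_le hpos)
      · exact (Nat.floor_lt hpos).1 hM₂
    | succ m ih =>
      refine hstep (m + 1) ih.ge ?_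
      rw [ih]
      exact Nat.cast_lt.2 (hτ.mono (Nat.lt_add_one _))
  obtain ⟨F, hF⟩ := hτ.exists_grid hM
  have hlt : ∀ a b, psi (α a) t0 < psi (α b) t0 ↔ S.f a (τ M) < S.f b (τ M) := fun a b => by
    rw [← relAt_floor hpos, hX, hτ.X_eq hM₁ hM₂]
    rfl
  have heF : e = fun p => F p.1.1 p.1.2 := by
    refine posIdx_unique (g := fun a => psi (α a) t0) (fun a b hab => ?_) he.1 he.2
      fun p q hpq => (hlt _ _).2 ?_
    · by_contra hne
      rcases StairSys.lt_or_gt (S := S) (hτ.T₁_lt M).le hne with h1 | h1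
      · exact ((hlt _ _).2 h1).ne hab
      · exact ((hlt _ _).2 h1).ne' hab
    · exact chain_lt (G := fun i j => S.f (F i j) (τ M)) (fun i j => hF.lt_diag)
        (fun i => hF.diag_lt) (fun i j => hF.lt_succ) hpq
  have heij : e (mkPos i j hij.le hj) = F i j := by rw [heF]; rfl
  rw [heij]
  obtain ⟨hmax, hL⟩ := hF.losses hij hj
  have hfun : (fun N : ℕ => psi (α (F i j)) N) = S.f (F i j) := funext fun N => (hS _ N).symm
  have hjump : ∀ m, 1 ≤ m → (m % k = (M + i + 1) % k ∨ m % k = (M + j + 1) % k) →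
      ¬ ContinuousAt (psi (α (F i j))) (τ m) := fun m h1 h2 =>
    psi_not_continuousAt (hfun ▸ StairSys.drops_of_mem_L (hτ.two_le m) ((hL m h1).2 h2))
  have hidx : ∀ c s, ts (c + 1 + s * k) = τ (M + c + 1 + s * k) := fun c s => by
    rw [show c + 1 + s * k = c + s * k + 1 by omega, hts']
    congr 2
    omega
  refine ⟨fun s => ⟨?_, ?_⟩, fun t ht hS' => ?_⟩
  · rw [hidx]
    exact hjump _ (by omega) (Or.inl (Nat.add_mul_mod_self_right _ _ _))
  · rw [hidx]
    exact hjump _ (by omega) (Or.inr (Nat.add_mul_mod_self_right _ _ _))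
  · rw [hts'] at ht
    have h2 : (2 : ℝ) ≤ τ (M + i + 1) := by exact_mod_cast hτ.two_le _
    refine psi_continuousAt (h2.trans ht) fun N hN hd => ?_
    rw [hfun] at hd
    have h3 : τ (M + i + 1) ≤ N := by
      rw [← hN] at ht
      exact_mod_cast ht
    obtain ⟨q, rfl, hq⟩ := hτ.exists_loss_of_drops hmax
      ((hτ.mono (by omega : k < M + i + 1)).trans_le h3) hd
    have h4 := hτ.mono.le_iff_le.1 h3
    rcases (hL q (by omega)).1 hq with h5 | h5
    · obtain ⟨s, h6⟩ := (Nat.modEq_iff_dvd' h4).1 h5.symm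
      refine (hS' s).1 ?_
      rw [hidx, ← hN]
      congr 2
      rw [mul_comm]
      omega
    · have h6 : M + j + 1 ≤ q := by
        by_contra hcon
        exact hτ.mod_ne (by omega : q < M + j + 1) (by omega) h5
      obtain ⟨s, h7⟩ := (Nat.modEq_iff_dvd' h6).1 h5.symm
      refine (hS' s).2 ?_
      rw [hidx, ← hN]
      congr 2
      rw [mul_comm]
      omega
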